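/- arXiv:1309.0253 — 2 statements merged into one kernel-verified Lean document; each statement's English description precedes it below -/
import Mathlib

section
/- (Wolff's theorem.) Let g, f_1, ..., f_n be bounded analytic functions on the unit disk D. If |g(z)| ≤ (Σ_{j=1}^n |f_j(z)|^2)^{1/2} for all z ∈ D, then g^3 belongs to the ideal generated by f_1, ..., f_n in H^∞(D); that is, there exist g_1, ..., g_n ∈ H^∞(D) with Σ_{j=1}^n f_j g_j = g^3 on D. -/
open MeasureTheory Complex Metric Set Filter
open scoped ENNReal Real

noncomputable section

/-- The open unit disk in `ℂ`. -/
def unitDisk : Set ℂ := Metric.ball 0 1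

/-- The Möbius automorphism `φ_a(z) = (a - z)/(1 - ā z)` of the unit disk. -/
def moebius (a z : ℂ) : ℂ := (a - z) / (1 - (starRingEnd ℂ) a * z)

/-- Membership in `H^∞(𝔻)`: bounded analytic functions on the unit disk. -/
def MemHinf (f : ℂ → ℂ) : Prop :=
  DifferentiableOn ℂ f unitDisk ∧ ∃ M : ℝ, ∀ z ∈ unitDisk, ‖f z‖ ≤ M

/-- The integral `∫_𝔻 |f'(z)|² (1 - |φ_a(z)|²)^p dA(z)`. -/
def qpIntegral (p : ℝ) (f : ℂ → ℂ) (a : ℂ) : ℝ≥0∞ :=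
  ∫⁻ z in unitDisk, ENNReal.ofReal (‖deriv f z‖ ^ 2 * (1 - ‖moebius a z‖ ^ 2) ^ p)

/-- Finiteness of the `H²`-part of the `Q_p` norm: the integrals of `|f|²` over circles of
radius `r < 1` are uniformly bounded (equivalently, the boundary integral `∫ |f|² dσ`
is finite). -/
def h2Bounded (f : ℂ → ℂ) : Prop :=
  ∃ M : ℝ, ∀ r ∈ Set.Ico (0 : ℝ) 1,
    (∫ t in (0 : ℝ)..(2 * Real.pi), ‖f ((r : ℂ) * Complex.exp (Complex.I * t))‖ ^ 2) ≤ M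

/-- Membership in the space `Q_p`: `f` is analytic on the unit disk and
`‖f‖_{Q_p}² = ∫_𝕋 |f|² dσ + sup_{a ∈ 𝔻} ∫_𝔻 |f'(z)|² (1 - |φ_a(z)|²)^p dA(z) < ∞`. -/
def MemQp (p : ℝ) (f : ℂ → ℂ) : Prop :=
  DifferentiableOn ℂ f unitDisk ∧ h2Bounded f ∧
    ∃ C : ℝ, ∀ a ∈ unitDisk, qpIntegral p f a ≤ ENNReal.ofReal C

/-- The multiplier algebra `M(Q_p)`. -/
def MemMQp (p : ℝ) (φ : ℂ → ℂ) : Prop :=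
  MemQp p φ ∧ ∀ f : ℂ → ℂ, MemQp p f → MemQp p (fun z => φ z * f z)

/-- The Carleson square `S(I)` over the arc of the unit circle centered at `e^{iθ}` with
normalized length `h`. -/
def carlesonBox (θ h : ℝ) : Set ℂ :=
  {z : ℂ | 1 - h < ‖z‖ ∧ ‖z‖ < 1 ∧
    ∃ t : ℝ, |t - θ| < Real.pi * h ∧ z = (‖z‖ : ℂ) * Complex.exp (Complex.I * t)}

/-- A measure `μ` on the unit disk is a `p`-Carleson measure if `μ(S(I)) ≤ C |I|^p`
for every arc `I` of the unit circle. -/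
def IsPCarleson (p : ℝ) (μ : Measure ℂ) : Prop :=
  ∃ C : ℝ, ∀ θ : ℝ, ∀ h ∈ Set.Ioc (0 : ℝ) 1,
    μ (carlesonBox θ h) ≤ ENNReal.ofReal (C * h ^ p)

/-- The `p`-Carleson constant `‖μ‖_p = sup_{I ⊂ 𝕋} μ(S(I))/|I|^p`. -/
def pCarlesonNorm (p : ℝ) (μ : Measure ℂ) : ℝ≥0∞ :=
  ⨆ (θ : ℝ) (h : ℝ) (_ : h ∈ Set.Ioc (0 : ℝ) 1),
    μ (carlesonBox θ h) / ENNReal.ofReal (h ^ p)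

/-- The measure `w(z) dA(z)` on the unit disk. -/
def diskMeasure (w : ℂ → ℝ) : Measure ℂ :=
  (volume.restrict unitDisk).withDensity fun z => ENNReal.ofReal (w z)

/-- The Wirtinger derivative `∂F/∂z`. -/
def wderiv (F : ℂ → ℂ) (z : ℂ) : ℂ :=
  (fderiv ℝ F z 1 - Complex.I * fderiv ℝ F z Complex.I) / 2

/-- The Wirtinger derivative `∂F/∂z̄`. -/
def wderivBar (F : ℂ → ℂ) (z : ℂ) : ℂ :=
  (fderiv ℝ F z 1 + Complex.I * fderiv ℝ F z Complex.I) / 2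

/-- The squared length of the (real) gradient: `|∇F|² = 2|∂F/∂z|² + 2|∂F/∂z̄|²`. -/
def gradSq (F : ℂ → ℂ) (z : ℂ) : ℝ :=
  2 * ‖wderiv F z‖ ^ 2 + 2 * ‖wderivBar F z‖ ^ 2

/-- The arc of the unit circle centered at `e^{iθ}` of normalized length `h`, parametrized
by angle. -/
def arcInterval (θ h : ℝ) : Set ℝ := Set.Ioo (θ - Real.pi * h) (θ + Real.pi * h)

/-- The double integral `∫_I ∫_I |f(ξ) - f(η)|²/|ξ - η|^{2-p} |dξ| |dη|` over the arc
centered at `e^{iθ}` of normalized length `h`. -/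
def qpTDouble (p : ℝ) (f : ℝ → ℂ) (θ h : ℝ) : ℝ≥0∞ :=
  ∫⁻ s in arcInterval θ h, ∫⁻ u in arcInterval θ h,
    ENNReal.ofReal (‖f s - f u‖ ^ 2 /
      ‖Complex.exp (Complex.I * s) - Complex.exp (Complex.I * u)‖ ^ (2 - p))

/-- The integral `∫_𝕋 |f|² dσ` of a function on the unit circle (parametrized by angle). -/
def l2Circle (f : ℝ → ℂ) : ℝ≥0∞ :=
  ∫⁻ t in Set.Ioc (0 : ℝ) (2 * Real.pi), (‖f t‖₊ : ℝ≥0∞) ^ 2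

/-- Membership in `Q_p(𝕋)` for a function on the unit circle (parametrized by angle):
`f ∈ L²(𝕋)` and `sup_{I ⊂ 𝕋} |I|^{-p} ∫_I ∫_I |f(ξ) - f(η)|²/|ξ - η|^{2-p} |dξ||dη| < ∞`. -/
def MemQpT (p : ℝ) (f : ℝ → ℂ) : Prop :=
  Function.Periodic f (2 * Real.pi) ∧ Measurable f ∧ l2Circle f < ⊤ ∧
    ∃ C : ℝ, ∀ θ : ℝ, ∀ h ∈ Set.Ioc (0 : ℝ) 1, qpTDouble p f θ h ≤ ENNReal.ofReal (C * h ^ p)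

/-- The square of the `Q_p` norm of an analytic function `f` on the disk with boundary
values `fb`. -/
def qpNormSq (p : ℝ) (f : ℂ → ℂ) (fb : ℝ → ℂ) : ℝ≥0∞ :=
  l2Circle fb + ⨆ a ∈ unitDisk, qpIntegral p f a

/-- The square of the `Q_p(𝕋)` norm of a function on the unit circle. -/
def qpTNormSq (p : ℝ) (fb : ℝ → ℂ) : ℝ≥0∞ :=
  l2Circle fb + ⨆ (θ : ℝ) (h : ℝ) (_ : h ∈ Set.Ioc (0 : ℝ) 1),
    qpTDouble p fb θ h / ENNReal.ofReal (h ^ p)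

/-- `fb` is the a.e. radial boundary-value function of `F`. -/
def RadialLimit (F : ℂ → ℂ) (fb : ℝ → ℂ) : Prop :=
  ∀ᵐ t : ℝ, Filter.Tendsto (fun r : ℝ => F ((r : ℂ) * Complex.exp (Complex.I * t)))
    (nhdsWithin 1 (Set.Iio 1)) (nhds (fb t))

/-- The Poisson integral (harmonic extension) of a function on the unit circle. -/
def poissonExt (f : ℝ → ℂ) (z : ℂ) : ℂ :=
  (1 / (2 * Real.pi)) • ∫ t in (0 : ℝ)..(2 * Real.pi),
    ((1 - ‖z‖ ^ 2) / ‖Complex.exp (Complex.I * t) - z‖ ^ 2) • f t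


/-- `V` has Wirtinger derivatives `a = ∂V`, `b = ∂̄V` at `z`. -/
def HasW (V : ℂ → ℂ) (a b z : ℂ) : Prop :=
  HasFDerivAt V (a • (ContinuousLinearMap.id ℝ ℂ) + b • (conjCLE : ℂ →L[ℝ] ℂ)) z

theorem HasW.congr_d {V : ℂ → ℂ} {a b a' b' z : ℂ} (h : HasW V a b z) (ha : a = a') (hb : b = b') :
    HasW V a' b' z := by subst ha; subst hb; exact h

theorem HasW.of_hasDerivAt {V : ℂ → ℂ} {a z : ℂ} (h : HasDerivAt V a z) : HasW V a 0 z := by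
  have h1 := h.hasFDerivAt.restrictScalars ℝ
  unfold HasW
  refine h1.congr_fderiv ?_
  ext <;> simp [mul_comm]

theorem HasW.conj {V : ℂ → ℂ} {a b z : ℂ} (h : HasW V a b z) :
    HasW (fun w => (starRingEnd ℂ) (V w)) ((starRingEnd ℂ) b) ((starRingEnd ℂ) a) z := by
  have h1 := ((conjCLE : ℂ →L[ℝ] ℂ).hasFDerivAt (x := V z)).comp z h
  refine h1.congr_fderiv ?_
  ext <;> simp [add_comm]

theorem HasW.add {V U : ℂ → ℂ} {a b c d z : ℂ} (h : HasW V a b z) (h' : HasW U c d z) :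
    HasW (fun w => V w + U w) (a + c) (b + d) z := by
  refine (HasFDerivAt.add h h').congr_fderiv ?_
  ext <;> simp <;> ring

theorem HasW.mul {V U : ℂ → ℂ} {a b c d z : ℂ} (h : HasW V a b z) (h' : HasW U c d z) :
    HasW (fun w => V w * U w) (a * U z + V z * c) (b * U z + V z * d) z := by
  refine (HasFDerivAt.mul h h').congr_fderiv ?_
  ext <;> simp <;> ring

theorem HasW.const (c z : ℂ) : HasW (fun _ => c) 0 0 z := HasW.of_hasDerivAt (hasDerivAt_const z c)

theorem HasW.id (z : ℂ) : HasW (fun w => w) 1 0 z := HasW.of_hasDerivAt (hasDerivAt_id z)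

theorem HasW.sum {ι : Type*} (s : Finset ι) {V : ι → ℂ → ℂ} {a b : ι → ℂ} {z : ℂ}
    (h : ∀ i ∈ s, HasW (V i) (a i) (b i) z) :
    HasW (fun w => ∑ i ∈ s, V i w) (∑ i ∈ s, a i) (∑ i ∈ s, b i) z := by
  refine (HasFDerivAt.fun_sum h).congr_fderiv ?_
  ext <;> simp [Finset.sum_add_distrib, Finset.sum_mul]

/-- chain rule with a holomorphic outer function -/
theorem HasW.comp_hol {V F : ℂ → ℂ} {a b c z : ℂ} (h : HasW V a b z) (hF : HasDerivAt F c (V z)) :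
    HasW (fun w => F (V w)) (c * a) (c * b) z := by
  refine ((hF.hasFDerivAt.restrictScalars ℝ).comp z h).congr_fderiv ?_
  ext <;> simp <;> ring

theorem HasW.continuous {V a b : ℂ → ℂ} (h : ∀ z, HasW V (a z) (b z) z) : Continuous V :=
  continuous_iff_continuousAt.2 fun z => (h z).continuousAt

/-- rectangle of polar coordinates -/
def polRect : Set (ℝ × ℝ) := Icc ((0:ℝ), (0:ℝ)) ((1:ℝ), 2 * π)

/-- point of the plane with polar coordinates p -/
def polPt (p : ℝ × ℝ) : ℂ := (p.1 : ℂ) * Complex.exp (I * p.2)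

/-- integral over the unit disk (in polar coordinates) -/
def dI {E : Type*} [NormedAddCommGroup E] [NormedSpace ℝ E] (K : ℂ → E) : E :=
  ∫ p in polRect, p.1 • K (polPt p)

/-- integral over the unit circle -/
def cI {E : Type*} [NormedAddCommGroup E] [NormedSpace ℝ E] (K : ℂ → E) : E :=
  ∫ t in (0:ℝ)..(2 * π), K (Complex.exp (I * t))

theorem continuous_polPt : Continuous polPt := by unfold polPt; fun_prop

theorem polPt_norm_le {p : ℝ × ℝ} (hp : p ∈ polRect) : ‖polPt p‖ ≤ 1 := by
  have h1 := hp.1.1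
  have h2 := hp.2.1
  simp only at h1 h2
  unfold polPt
  rw [norm_mul, mul_comm I, Complex.norm_exp_ofReal_mul_I, mul_one, Complex.norm_real,
    Real.norm_eq_abs, abs_of_nonneg h1]
  exact h2

theorem dI_int {E : Type*} [NormedAddCommGroup E] [NormedSpace ℝ E] {K : ℂ → E}
    (hK : Continuous K) : IntegrableOn (fun p : ℝ × ℝ => p.1 • K (polPt p)) polRect := by
  apply ContinuousOn.integrableOn_compact isCompact_Icc
  have := continuous_polPt
  fun_prop

theorem cI_int {E : Type*} [NormedAddCommGroup E] [NormedSpace ℝ E] {K : ℂ → E}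
    (hK : Continuous K) :
    IntervalIntegrable (fun t : ℝ => K (Complex.exp (I * t))) volume 0 (2 * π) := by
  apply Continuous.intervalIntegrable
  fun_prop

theorem dI_add {E : Type*} [NormedAddCommGroup E] [NormedSpace ℝ E] {K L : ℂ → E}
    (hK : Continuous K) (hL : Continuous L) : dI (fun z => K z + L z) = dI K + dI L := by
  unfold dI
  simp only [smul_add]
  exact integral_add (dI_int hK) (dI_int hL)

theorem cI_add {E : Type*} [NormedAddCommGroup E] [NormedSpace ℝ E] {K L : ℂ → E}
    (hK : Continuous K) (hL : Continuous L) : cI (fun z => K z + L z) = cI K + cI L := by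
  unfold cI
  exact intervalIntegral.integral_add (cI_int hK) (cI_int hL)

theorem dI_const_mul (c : ℝ) (K : ℂ → ℝ) : dI (fun z => c * K z) = c * dI K := by
  unfold dI
  rw [← integral_const_mul]
  congr 1; ext p; simp; ring

theorem cI_const_mul (c : ℝ) (K : ℂ → ℝ) : cI (fun z => c * K z) = c * cI K := by
  unfold cI
  rw [← intervalIntegral.integral_const_mul]

theorem dI_mono {K L : ℂ → ℝ} (hK : Continuous K) (hL : Continuous L)
    (h : ∀ z, ‖z‖ ≤ 1 → K z ≤ L z) : dI K ≤ dI L := by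
  unfold dI
  apply setIntegral_mono_on (dI_int hK) (dI_int hL) measurableSet_Icc
  intro p hp
  have h1 := hp.1.1
  simp only at h1
  exact mul_le_mul_of_nonneg_left (h _ (polPt_norm_le hp)) h1

theorem circ_norm (t : ℝ) : ‖Complex.exp (I * t)‖ = 1 := by
  rw [mul_comm, Complex.norm_exp_ofReal_mul_I]

theorem cI_mono {K L : ℂ → ℝ} (hK : Continuous K) (hL : Continuous L)
    (h : ∀ z, ‖z‖ = 1 → K z ≤ L z) : cI K ≤ cI L := by
  unfold cI
  apply intervalIntegral.integral_mono_on (by positivity) (cI_int hK) (cI_int hL)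
  intro t _
  exact h _ (circ_norm t)

theorem cI_congr {E : Type*} [NormedAddCommGroup E] [NormedSpace ℝ E] {K L : ℂ → E}
    (h : ∀ z, ‖z‖ = 1 → K z = L z) : cI K = cI L := by
  unfold cI
  congr 1; ext t; exact h _ (circ_norm t)

theorem dI_nonneg {K : ℂ → ℝ} (h : ∀ z, ‖z‖ ≤ 1 → 0 ≤ K z) : 0 ≤ dI K := by
  unfold dI
  apply setIntegral_nonneg measurableSet_Icc
  intro p hp
  exact mul_nonneg hp.1.1 (h _ (polPt_norm_le hp))

theorem cI_nonneg {K : ℂ → ℝ} (h : ∀ z, ‖z‖ = 1 → 0 ≤ K z) : 0 ≤ cI K := by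
  unfold cI
  apply intervalIntegral.integral_nonneg (by positivity)
  intro t _
  exact h _ (circ_norm t)

theorem dI_norm_le (K : ℂ → ℂ) : ‖dI K‖ ≤ dI (fun z => ‖K z‖) := by
  unfold dI
  refine (norm_integral_le_integral_norm _).trans (le_of_eq ?_)
  apply setIntegral_congr_fun measurableSet_Icc
  intro p hp
  have h1 : 0 ≤ p.1 := hp.1.1
  simp [norm_smul, abs_of_nonneg h1]

theorem cI_norm_le (K : ℂ → ℂ) : ‖cI K‖ ≤ cI (fun z => ‖K z‖) := by
  unfold cI
  exact intervalIntegral.norm_integral_le_integral_norm (by positivity)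

theorem dI_re {K : ℂ → ℂ} (hK : Continuous K) : (dI K).re = dI (fun z => (K z).re) := by
  unfold dI
  have := ContinuousLinearMap.integral_comp_comm reCLM (dI_int hK)
  simp only [reCLM_apply] at this
  rw [← this]; simp

theorem cI_re {K : ℂ → ℂ} (hK : Continuous K) : (cI K).re = cI (fun z => (K z).re) := by
  unfold cI
  have := ContinuousLinearMap.intervalIntegral_comp_comm reCLM (cI_int hK)
  simp only [reCLM_apply] at this
  rw [← this]

theorem dI_conj (K : ℂ → ℂ) :
    dI (fun z => (starRingEnd ℂ) (K z)) = (starRingEnd ℂ) (dI K) := by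
  unfold dI
  rw [← integral_conj]
  simp

theorem cI_conj (K : ℂ → ℂ) :
    cI (fun z => (starRingEnd ℂ) (K z)) = (starRingEnd ℂ) (cI K) := by
  unfold cI
  rw [intervalIntegral.integral_of_le (by positivity), intervalIntegral.integral_of_le (by positivity),
    ← integral_conj]

theorem dI_sum {ι : Type*} (s : Finset ι) {K : ι → ℂ → ℝ} (hK : ∀ i, Continuous (K i)) :
    dI (fun z => ∑ i ∈ s, K i z) = ∑ i ∈ s, dI (K i) := by
  unfold dI
  simp only [Finset.smul_sum]
  exact integral_finsetSum s fun i _ => dI_int (hK i)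

theorem cI_sum {ι : Type*} (s : Finset ι) {K : ι → ℂ → ℝ} (hK : ∀ i, Continuous (K i)) :
    cI (fun z => ∑ i ∈ s, K i z) = ∑ i ∈ s, cI (K i) := by
  unfold cI
  exact intervalIntegral.integral_finsetSum fun i _ => cI_int (hK i)

/-- Stokes for `∂̄`. -/
theorem stokes_bar {V a b : ℂ → ℂ} (h : ∀ z, HasW V (a z) (b z) z) (hb : Continuous b) :
    2 * dI b = cI (fun z => z * V z) := by
  have hV : Continuous V := HasW.continuous h
  set e : ℝ × ℝ → ℂ := fun p => Complex.exp (I * p.2) with he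
  have hecont : Continuous e := by fun_prop
  have hed : ∀ p, HasFDerivAt e ((e p * I) • (ofRealCLM.comp (ContinuousLinearMap.snd ℝ ℝ ℝ))) p := by
    intro p
    have h1 : HasFDerivAt (fun p : ℝ × ℝ => I * (p.2 : ℂ))
        (I • (ofRealCLM.comp (ContinuousLinearMap.snd ℝ ℝ ℝ))) p := by
      have := (ofRealCLM.comp (ContinuousLinearMap.snd ℝ ℝ ℝ)).hasFDerivAt (x := p)
      exact this.const_mul I
    refine h1.cexp.congr_fderiv ?_
    ext <;> simp [he]
  have hpd : ∀ p, HasFDerivAt polPt ((e p) • (ofRealCLM.comp (ContinuousLinearMap.fst ℝ ℝ ℝ)) +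
      (p.1 * (e p * I)) • (ofRealCLM.comp (ContinuousLinearMap.snd ℝ ℝ ℝ))) p := by
    intro p
    have h0 : HasFDerivAt (fun p : ℝ × ℝ => (p.1 : ℂ))
        (ofRealCLM.comp (ContinuousLinearMap.fst ℝ ℝ ℝ)) p :=
      (ofRealCLM.comp (ContinuousLinearMap.fst ℝ ℝ ℝ)).hasFDerivAt (x := p)
    refine (h0.mul (hed p)).congr_fderiv ?_
    ext <;> simp
  have hVd := fun p => (h (polPt p)).comp p (hpd p)
  have h0 : ∀ p : ℝ × ℝ, HasFDerivAt (fun p : ℝ × ℝ => (p.1 : ℂ))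
        (ofRealCLM.comp (ContinuousLinearMap.fst ℝ ℝ ℝ)) p := fun p =>
      (ofRealCLM.comp (ContinuousLinearMap.fst ℝ ℝ ℝ)).hasFDerivAt (x := p)
  set PD : ℝ × ℝ → ℝ × ℝ →L[ℝ] ℂ := fun p => ((e p) • (ofRealCLM.comp (ContinuousLinearMap.fst ℝ ℝ ℝ)) +
      (p.1 * (e p * I)) • (ofRealCLM.comp (ContinuousLinearMap.snd ℝ ℝ ℝ))) with hPD
  set VD : ℝ × ℝ → ℝ × ℝ →L[ℝ] ℂ := fun p =>
    ((a (polPt p) • ContinuousLinearMap.id ℝ ℂ + b (polPt p) • (conjCLE : ℂ →L[ℝ] ℂ)).comp (PD p)) with hVDd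
  set F' : ℝ × ℝ → ℝ × ℝ →L[ℝ] ℂ := fun p =>
    polPt p • VD p + (V ∘ polPt) p • PD p with hF'
  set G' : ℝ × ℝ → ℝ × ℝ →L[ℝ] ℂ := fun p => (I * e p) • VD p +
    (V ∘ polPt) p • I • ((e p * I) • (ofRealCLM.comp (ContinuousLinearMap.snd ℝ ℝ ℝ))) with hG'
  have hF : ∀ p, HasFDerivAt (fun p => polPt p * (V ∘ polPt) p) (F' p) p :=
    fun p => (hpd p).mul (hVd p)
  have hG : ∀ p, HasFDerivAt (fun p => I * e p * (V ∘ polPt) p) (G' p) p :=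
    fun p => ((hed p).const_mul I).mul (hVd p)
  have key := integral_divergence_prod_Icc_of_hasFDerivAt_of_le
    (fun p => polPt p * (V ∘ polPt) p) (fun p => I * e p * (V ∘ polPt) p) F' G'
    ((0:ℝ), (0:ℝ)) ((1:ℝ), 2 * π) ⟨by simp, by simp; positivity⟩
    (by have := continuous_polPt; fun_prop) (by have := continuous_polPt; fun_prop)
    (fun p _ => hF p) (fun p _ => hG p)
  have hee : ∀ p, e p * (starRingEnd ℂ) (e p) = 1 := by
    intro p
    rw [Complex.mul_conj, Complex.normSq_eq_norm_sq, he]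
    simp
  have hintg : (fun p => F' p (1, 0) + G' p (0, 1)) = fun p => p.1 • (2 * b (polPt p)) := by
    funext p
    have h1 := hee p
    have h2 : polPt p = p.1 * e p := rfl
    have h3 := Complex.I_mul_I
    simp only [hF', hG', hVDd, hPD, ContinuousLinearMap.add_apply, ContinuousLinearMap.smul_apply,
      ContinuousLinearMap.comp_apply, smul_eq_mul, ContinuousLinearMap.coe_fst',
      ContinuousLinearMap.coe_snd', ofRealCLM_apply, ContinuousLinearMap.id_apply]
    simp only [real_smul, ofReal_one, ofReal_zero, mul_one, mul_zero, add_zero, zero_add,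
      ContinuousLinearEquiv.coe_coe, conjCLE_apply, map_mul, conj_I, conj_ofReal]
    rw [h2]
    generalize b (p.1 * e p) = B
    generalize a (p.1 * e p) = A
    generalize (V ∘ polPt) p = v
    generalize (starRingEnd ℂ) (e p) = ec at *
    linear_combination (2 * (p.1:ℂ) * B) * h1 + (A * p.1 * e p ^ 2 + v * e p - B * p.1 * e p * ec) * h3
  have h2b : Continuous fun z => 2 * b z := by fun_prop
  rw [hintg] at key
  have key2 := key (dI_int h2b)
  have e1 : (∫ x in Icc ((0:ℝ), (0:ℝ)) ((1:ℝ), 2 * π), x.1 • (2 * b (polPt x))) = 2 * dI b := by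
    unfold dI polRect
    rw [← integral_const_mul]
    congr 1; ext p; simp; ring
  have e2 : ∀ x : ℝ, e (x, 2 * π) = 1 := by
    intro x; simp [he]; rw [mul_comm]; exact Complex.exp_two_pi_mul_I
  have e3 : ∀ x : ℝ, e (x, 0) = 1 := by
    intro x; simp [he]
  have e4 : ∀ p : ℝ × ℝ, polPt p = p.1 * e p := fun p => rfl
  rw [e1] at key2
  rw [key2]
  simp only [Function.comp_apply, e4, e2, e3]
  simp [cI, he]

/-- Stokes for `∂`. -/
theorem stokes_d {V a b : ℂ → ℂ} (h : ∀ z, HasW V (a z) (b z) z) (ha : Continuous a) :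
    2 * dI a = cI (fun z => (starRingEnd ℂ) z * V z) := by
  have h1 := stokes_bar (V := fun z => (starRingEnd ℂ) (V z)) (fun z => (h z).conj)
    (by exact Complex.continuous_conj.comp ha)
  have h2 := congrArg (starRingEnd ℂ) h1
  rw [dI_conj, ← cI_conj] at h2
  rw [map_mul, map_ofNat] at h2
  simpa using h2

theorem one_sub_circ {z : ℂ} (hz : ‖z‖ = 1) : 1 - z * (starRingEnd ℂ) z = 0 := by
  rw [Complex.mul_conj, Complex.normSq_eq_norm_sq, hz]; simp

theorem hasW_dl (z : ℂ) : HasW (fun w => 1 - w * (starRingEnd ℂ) w) (-(starRingEnd ℂ) z) (-z) z := by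
  have h := (HasW.const 1 z).add ((HasW.const (-1) z).mul ((HasW.id z).mul (HasW.id z).conj))
  have e : (fun w : ℂ => 1 - w * (starRingEnd ℂ) w) = fun w => 1 + (-1) * (w * (starRingEnd ℂ) w) := by
    funext w; ring
  rw [e]
  exact h.congr_d (by simp) (by simp)

theorem cI_zero' {K : ℂ → ℂ} (h : ∀ z, ‖z‖ = 1 → K z = 0) : cI K = 0 := by
  rw [cI_congr h]; simp [cI]

/-- weighted Green formula -/
theorem green {S a b c d : ℂ → ℂ} (h : ∀ z, HasW S (a z) (b z) z) (h' : ∀ z, HasW b (c z) (d z) z)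
    (hc : Continuous c) :
    2 * dI (fun z => (1 - z * (starRingEnd ℂ) z) * c z) + 2 * dI S = cI S := by
  have hS := HasW.continuous h
  have hb := HasW.continuous h'
  have hcj := Complex.continuous_conj
  have h1 := stokes_d (fun z => (hasW_dl z).mul (h' z)) (by fun_prop)
  rw [cI_zero' (fun z hz => by rw [one_sub_circ hz]; simp)] at h1
  have h2 := stokes_bar (fun z => (HasW.id z).conj.mul (h z)) (by fun_prop)
  rw [dI_add (by fun_prop) (by fun_prop)] at h1 h2
  have e1 : dI (fun z => (-(starRingEnd ℂ) z) * b z) = - dI (fun z => (starRingEnd ℂ) z * b z) := by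
    unfold dI; rw [← integral_neg]; congr 1; ext p; simp
  have e2 : cI (fun z => z * ((starRingEnd ℂ) z * S z)) = cI S := by
    apply cI_congr
    intro z hz
    have := one_sub_circ hz
    linear_combination (-S z) * this
  rw [e2] at h2
  rw [e1] at h1
  simp only [map_one, one_mul] at h2
  linear_combination h1 + h2

/-- first order formula -/
theorem first_order {K k l : ℂ → ℂ} (h : ∀ z, HasW K (k z) (l z) z) (hk : Continuous k) :
    dI K = dI (fun z => 2 * (1 - z * (starRingEnd ℂ) z) * K z +
      z * (1 - z * (starRingEnd ℂ) z) * k z) := by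
  have hK := HasW.continuous h
  have hcj := Complex.continuous_conj
  have h1 := stokes_d (fun z => ((HasW.id z).mul (hasW_dl z)).mul (h z)) (by fun_prop)
  rw [cI_zero' (fun z hz => by rw [one_sub_circ hz]; simp)] at h1
  have h2 : dI (fun z => 2 * (1 - z * (starRingEnd ℂ) z) * K z +
      z * (1 - z * (starRingEnd ℂ) z) * k z) = dI (fun z => K z + ((1 * (1 - z * (starRingEnd ℂ) z) + z * -(starRingEnd ℂ) z) * K z +
        z * (1 - z * (starRingEnd ℂ) z) * k z)) := by
    congr 1; ext z; ring
  rw [h2, dI_add hK (by fun_prop)]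
  have : dI (fun z => ((1 * (1 - z * (starRingEnd ℂ) z) + z * -(starRingEnd ℂ) z) * K z +
        z * (1 - z * (starRingEnd ℂ) z) * k z)) = 0 := by
    simpa using h1
  rw [this, add_zero]

section
open Polynomial in

theorem hasW_poly (p : ℂ[X]) (z : ℂ) : HasW (fun w => p.eval w) (p.derivative.eval z) 0 z :=
  HasW.of_hasDerivAt (p.hasDerivAt z)

theorem mul_conj_norm (w : ℂ) : w * (starRingEnd ℂ) w = ((‖w‖ ^ 2 : ℝ) : ℂ) := by
  rw [Complex.mul_conj, Complex.normSq_eq_norm_sq]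

/-- real form of the Green formula -/
theorem green_re {S a b c d : ℂ → ℂ} (h : ∀ z, HasW S (a z) (b z) z)
    (h' : ∀ z, HasW b (c z) (d z) z) (hc : Continuous c) :
    2 * dI (fun z => (1 - ‖z‖ ^ 2) * (c z).re) + 2 * dI (fun z => (S z).re) =
      cI (fun z => (S z).re) := by
  have hS := HasW.continuous h
  have h1 := congrArg Complex.re (green h h' hc)
  have hcj := Complex.continuous_conj
  rw [cI_re hS, Complex.add_re] at h1
  rw [← h1, ← dI_re hS]
  have : dI (fun z => (1 - ‖z‖ ^ 2) * (c z).re) =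
      (dI (fun z => (1 - z * (starRingEnd ℂ) z) * c z)).re := by
    rw [dI_re (by fun_prop)]
    congr 1; ext z
    rw [mul_conj_norm, ← Complex.ofReal_one, ← Complex.ofReal_sub, Complex.re_ofReal_mul]
  rw [this]
  simp

/-- squared `L²` norm on the circle -/
def nT (p : Polynomial ℂ) : ℝ := cI (fun z => ‖p.eval z‖ ^ 2)

theorem nT_nonneg (p : Polynomial ℂ) : 0 ≤ nT p := cI_nonneg fun z _ => by positivity

theorem LP (p : Polynomial ℂ) :
    2 * dI (fun z => (1 - ‖z‖ ^ 2) * ‖p.derivative.eval z‖ ^ 2) + 2 * dI (fun z => ‖p.eval z‖ ^ 2) =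
      nT p := by
  have hcj := Complex.continuous_conj
  have hP := p.continuous
  have hP' := p.derivative.continuous
  have h := green_re (S := fun z => p.eval z * (starRingEnd ℂ) (p.eval z))
    (b := fun z => p.eval z * (starRingEnd ℂ) (p.derivative.eval z))
    (c := fun z => p.derivative.eval z * (starRingEnd ℂ) (p.derivative.eval z))
    (fun z => ((hasW_poly p z).mul (hasW_poly p z).conj).congr_d rfl (by simp))
    (fun z => ((hasW_poly p z).mul (hasW_poly p.derivative z).conj).congr_d (by simp) rfl)
    (by fun_prop)
  simp only [mul_conj_norm, Complex.ofReal_re] at h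
  exact h

theorem dl_nonneg {z : ℂ} (hz : ‖z‖ ≤ 1) : 0 ≤ 1 - ‖z‖ ^ 2 := by
  have := norm_nonneg z
  nlinarith

theorem LP1 (p : Polynomial ℂ) :
    dI (fun z => (1 - ‖z‖ ^ 2) * ‖p.derivative.eval z‖ ^ 2) ≤ nT p := by
  have h := LP p
  have h1 : 0 ≤ dI (fun z => ‖p.eval z‖ ^ 2) := dI_nonneg fun z _ => by positivity
  have h2 : 0 ≤ dI (fun z => (1 - ‖z‖ ^ 2) * ‖p.derivative.eval z‖ ^ 2) :=
    dI_nonneg fun z hz => mul_nonneg (dl_nonneg hz) (by positivity)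
  linarith

theorem LP2 (p : Polynomial ℂ) : dI (fun z => ‖p.eval z‖ ^ 2) ≤ nT p := by
  have h := LP p
  have h1 : 0 ≤ dI (fun z => ‖p.eval z‖ ^ 2) := dI_nonneg fun z _ => by positivity
  have h2 : 0 ≤ dI (fun z => (1 - ‖z‖ ^ 2) * ‖p.derivative.eval z‖ ^ 2) :=
    dI_nonneg fun z hz => mul_nonneg (dl_nonneg hz) (by positivity)
  linarith

theorem LP2' (p : Polynomial ℂ) : dI (fun z => (1 - ‖z‖ ^ 2) * ‖p.eval z‖ ^ 2) ≤ nT p := by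
  refine le_trans (dI_mono ?_ ?_ ?_) (LP2 p)
  · have hP := p.continuous
    fun_prop
  · have hP := p.continuous
    fun_prop
  · intro z hz
    have := sq_nonneg ‖z‖
    have h2 := sq_nonneg ‖p.eval z‖
    nlinarith

/-- sum of squares of moduli -/
def ssq {ι : Type*} [Fintype ι] (F : ι → Polynomial ℂ) (z : ℂ) : ℝ := ∑ i, ‖(F i).eval z‖ ^ 2

theorem ssq_nonneg {ι : Type*} [Fintype ι] (F : ι → Polynomial ℂ) (z : ℂ) : 0 ≤ ssq F z :=
  Finset.sum_nonneg fun i _ => by positivity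

theorem ssq_cont {ι : Type*} [Fintype ι] (F : ι → Polynomial ℂ) : Continuous (ssq F) := by
  unfold ssq
  have := fun i => (F i).continuous
  fun_prop

/-- derivatives of a family -/
def dF {ι : Type*} (F : ι → Polynomial ℂ) : ι → Polynomial ℂ := fun i => (F i).derivative

/-- cross sum of derivatives and conjugates -/
def crossA {ι : Type*} [Fintype ι] (F : ι → Polynomial ℂ) (z : ℂ) : ℂ :=
  ∑ i, (F i).derivative.eval z * (starRingEnd ℂ) ((F i).eval z)

theorem crossA_cont {ι : Type*} [Fintype ι] (F : ι → Polynomial ℂ) : Continuous (crossA F) := by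
  unfold crossA
  have := fun i => (F i).continuous
  have := fun i => (F i).derivative.continuous
  have hcj := Complex.continuous_conj
  fun_prop

theorem crossA_sq_le {ι : Type*} [Fintype ι] (F : ι → Polynomial ℂ) (z : ℂ) :
    ‖crossA F z‖ ^ 2 ≤ ssq (dF F) z * ssq F z := by
  have h1 : ‖crossA F z‖ ≤ ∑ i, ‖(F i).derivative.eval z‖ * ‖(F i).eval z‖ := by
    refine (norm_sum_le _ _).trans (le_of_eq ?_)
    simp
  calc ‖crossA F z‖ ^ 2 ≤ (∑ i, ‖(F i).derivative.eval z‖ * ‖(F i).eval z‖) ^ 2 := by gcongr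
    _ ≤ _ := Finset.sum_mul_sq_le_sq_mul_sq _ _ _

theorem hasW_ssq {ι : Type*} [Fintype ι] (F : ι → Polynomial ℂ) (z : ℂ) :
    HasW (fun w => (ssq F w : ℂ)) (crossA F z) ((starRingEnd ℂ) (crossA F z)) z := by
  have h := HasW.sum Finset.univ (fun i _ => (hasW_poly (F i) z).mul (hasW_poly (F i) z).conj)
  have e : (fun w => (ssq F w : ℂ)) =
      fun w => ∑ i, (F i).eval w * (starRingEnd ℂ) ((F i).eval w) := by
    funext w; simp only [mul_conj_norm, ssq]; push_cast; rfl
  rw [e]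
  exact h.congr_d (by simp [crossA]) (by simp [crossA, mul_comm])

theorem hasW_crossAbar {ι : Type*} [Fintype ι] (F : ι → Polynomial ℂ) (z : ℂ) :
    HasW (fun w => (starRingEnd ℂ) (crossA F w)) (ssq (dF F) z)
      (∑ i, (F i).eval z * (starRingEnd ℂ) ((F i).derivative.derivative.eval z)) z := by
  have h := HasW.sum Finset.univ (fun i _ => (hasW_poly (F i) z).mul (hasW_poly (F i).derivative z).conj)
  have e : (fun w => (starRingEnd ℂ) (crossA F w)) =
      fun w => ∑ i, (F i).eval w * (starRingEnd ℂ) ((F i).derivative.eval w) := by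
    funext w; simp [crossA, mul_comm]
  rw [e]
  refine h.congr_d ?_ ?_
  · simp only [map_zero, mul_zero, add_zero, mul_conj_norm, ssq, dF]
    push_cast; rfl
  · simp

/-- the norm of the family -/
def nu {ι : Type*} [Fintype ι] (F : ι → Polynomial ℂ) (z : ℂ) : ℝ := Real.sqrt (ssq F z)

theorem nu_cont {ι : Type*} [Fintype ι] (F : ι → Polynomial ℂ) : Continuous (nu F) :=
  (ssq_cont F).sqrt

theorem hasW_nu {ι : Type*} [Fintype ι] (F : ι → Polynomial ℂ) (hpos : ∀ z, 0 < ssq F z) (z : ℂ) :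
    HasW (fun w => (nu F w : ℂ)) (crossA F z * (nu F z : ℂ)⁻¹ / 2)
      ((starRingEnd ℂ) (crossA F z) * (nu F z : ℂ)⁻¹ / 2) z := by
  have e0 : ∀ w, ((ssq F w : ℂ)) ^ (1/2 : ℂ) = (nu F w : ℂ) := by
    intro w
    rw [nu, Real.sqrt_eq_rpow, Complex.ofReal_cpow (ssq_nonneg F w)]
    simp
  have hs : HasDerivAt (fun w : ℂ => w ^ (1/2 : ℂ)) ((nu F z : ℂ)⁻¹ / 2) (ssq F z : ℂ) := by
    have h0 : (1/2 - 1 : ℂ) = -(1/2) := by norm_num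
    have h1 := (hasDerivAt_id (ssq F z : ℂ)).cpow_const (c := (1/2:ℂ))
      (Complex.ofReal_mem_slitPlane.2 (hpos z))
    simp only [_root_.id] at h1
    rw [h0, Complex.cpow_neg, e0] at h1
    convert h1 using 1
    ring
  have h2 := (hasW_ssq F z).comp_hol hs
  simp only [e0] at h2
  exact h2.congr_d (by ring) (by ring)

theorem nu_pos {ι : Type*} [Fintype ι] {F : ι → Polynomial ℂ} (hpos : ∀ z, 0 < ssq F z) (z : ℂ) :
    0 < nu F z := Real.sqrt_pos.2 (hpos z)

theorem hasW_nui {ι : Type*} [Fintype ι] (F : ι → Polynomial ℂ) (hpos : ∀ z, 0 < ssq F z) (z : ℂ) :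
    HasW (fun w => (nu F w : ℂ)⁻¹) (-(crossA F z * ((nu F z : ℂ)⁻¹) ^ 3 / 2))
      (-((starRingEnd ℂ) (crossA F z) * ((nu F z : ℂ)⁻¹) ^ 3 / 2)) z := by
  have hne : (nu F z : ℂ) ≠ 0 := by exact_mod_cast (nu_pos hpos z).ne'
  have h := (hasW_nu F hpos z).comp_hol (hasDerivAt_inv hne)
  exact h.congr_d (by field_simp) (by field_simp)

theorem L3_pt {al be v D a x : ℝ} (hal : 0 ≤ al) (hbe : 0 ≤ be) (hv : 0 < v) (hD : 0 ≤ D)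
    (ha : a ^ 2 ≤ D ^ 2 * v ^ 2) (ha0 : 0 ≤ a) (hx : |x| ≤ al * be * a) :
    al ^ 2 * D ^ 2 / v / 8 - be ^ 2 * v ≤ be ^ 2 * v + x * v⁻¹ + al ^ 2 * D ^ 2 * v⁻¹ / 2
      - al ^ 2 * a ^ 2 * v⁻¹ ^ 3 / 4 := by
  have ha' : a ≤ D * v := by
    apply le_of_sq_le_sq _ (by positivity)
    nlinarith
  have hx1 : -(al * be * D) ≤ x * v⁻¹ := by
    have h1 : -(al * be * a) ≤ x := (abs_le.1 hx).1
    have h2 : al * be * a ≤ al * be * (D * v) := by gcongr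
    rw [← div_eq_mul_inv, le_div_iff₀ hv]
    nlinarith
  have hx2 : al ^ 2 * a ^ 2 * v⁻¹ ^ 3 ≤ al ^ 2 * D ^ 2 * v⁻¹ := by
    have : al ^ 2 * D ^ 2 * v⁻¹ = al ^ 2 * (D ^ 2 * v ^ 2) * v⁻¹ ^ 3 := by field_simp
    rw [this]
    gcongr
  have hx3 : al * be * D ≤ 2 * be ^ 2 * v + al ^ 2 * D ^ 2 * v⁻¹ / 8 := by
    have : 0 ≤ (4 * be * v - al * D) ^ 2 * (v⁻¹ / 8) := by positivity
    have e : (4 * be * v - al * D) ^ 2 * (v⁻¹ / 8) =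
      2 * be ^ 2 * v + al ^ 2 * D ^ 2 * v⁻¹ / 8 - al * be * D := by field_simp; ring
    linarith
  have hdiv : al ^ 2 * D ^ 2 / v = al ^ 2 * D ^ 2 * v⁻¹ := div_eq_mul_inv _ _
  rw [hdiv]
  linarith

theorem L3 {ι : Type*} [Fintype ι] (F : ι → Polynomial ℂ) (hpos : ∀ z, 0 < ssq F z) (R : ℝ)
    (hR : ∀ z, ‖z‖ ≤ 1 → nu F z ≤ R) (p : Polynomial ℂ) :
    dI (fun z => (1 - ‖z‖ ^ 2) * (‖p.eval z‖ ^ 2 * ssq (dF F) z / nu F z)) ≤ 16 * R * nT p := by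
  have hcj := Complex.continuous_conj
  have hP := p.continuous
  have hP' := p.derivative.continuous
  have hA := crossA_cont F
  have hs := ssq_cont F
  have hs' := ssq_cont (dF F)
  have hn := nu_cont F
  have hne : ∀ z, nu F z ≠ 0 := fun z => (nu_pos hpos z).ne'
  have hneC : ∀ z, (nu F z : ℂ) ≠ 0 := fun z => by exact_mod_cast hne z
  have hni : Continuous fun z => (nu F z : ℂ)⁻¹ :=
    Continuous.inv₀ (Complex.continuous_ofReal.comp hn) hneC
  have hniR : Continuous fun z => (nu F z)⁻¹ := Continuous.inv₀ hn hne
  have hnC : Continuous fun z => (nu F z : ℂ) := (Complex.continuous_ofReal.comp hn)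
  have hsC' : Continuous fun z => (ssq (dF F) z : ℂ) := (Complex.continuous_ofReal.comp hs')
  have hR0 : 0 ≤ R := (nu_pos hpos 0).le.trans (hR 0 (by simp))
  have h := green_re
    (S := fun z => p.eval z * (starRingEnd ℂ) (p.eval z) * (nu F z : ℂ))
    (b := fun z => p.eval z * (starRingEnd ℂ) (p.derivative.eval z) * (nu F z : ℂ) +
      p.eval z * (starRingEnd ℂ) (p.eval z) * (1/2) * ((starRingEnd ℂ) (crossA F z) * (nu F z : ℂ)⁻¹))
    (c := fun z => p.derivative.eval z * (starRingEnd ℂ) (p.derivative.eval z) * (nu F z : ℂ) +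
      p.eval z * (starRingEnd ℂ) (p.derivative.eval z) * (crossA F z * (nu F z : ℂ)⁻¹ / 2) +
      p.derivative.eval z * (starRingEnd ℂ) (p.eval z) * (1/2) *
        ((starRingEnd ℂ) (crossA F z) * (nu F z : ℂ)⁻¹) +
      p.eval z * (starRingEnd ℂ) (p.eval z) * (1/2) * (ssq (dF F) z * (nu F z : ℂ)⁻¹ -
        (starRingEnd ℂ) (crossA F z) * (crossA F z * ((nu F z : ℂ)⁻¹) ^ 3 / 2)))
    (fun z => (((hasW_poly p z).mul (hasW_poly p z).conj).mul (hasW_nu F hpos z)).congr_d rfl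
      (by simp; ring))
    (fun z => ((((hasW_poly p z).mul (hasW_poly p.derivative z).conj).mul (hasW_nu F hpos z)).add
      ((((hasW_poly p z).mul (hasW_poly p z).conj).mul (HasW.const (1/2) z)).mul
        ((hasW_crossAbar F z).mul (hasW_nui F hpos z)))).congr_d (by simp; ring) rfl)
    (by fun_prop)
  have hre : ∀ z, (‖p.eval z‖ ^ 2 * ssq (dF F) z / nu F z) / 8 - ‖p.derivative.eval z‖ ^ 2 * nu F z ≤
      (p.derivative.eval z * (starRingEnd ℂ) (p.derivative.eval z) * (nu F z : ℂ) +
      p.eval z * (starRingEnd ℂ) (p.derivative.eval z) * (crossA F z * (nu F z : ℂ)⁻¹ / 2) +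
      p.derivative.eval z * (starRingEnd ℂ) (p.eval z) * (1/2) *
        ((starRingEnd ℂ) (crossA F z) * (nu F z : ℂ)⁻¹) +
      p.eval z * (starRingEnd ℂ) (p.eval z) * (1/2) * (ssq (dF F) z * (nu F z : ℂ)⁻¹ -
        (starRingEnd ℂ) (crossA F z) * (crossA F z * ((nu F z : ℂ)⁻¹) ^ 3 / 2))).re := by
    intro z
    set w := p.eval z * (starRingEnd ℂ) (p.derivative.eval z) * crossA F z with hw
    have e : (p.derivative.eval z * (starRingEnd ℂ) (p.derivative.eval z) * (nu F z : ℂ) +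
      p.eval z * (starRingEnd ℂ) (p.derivative.eval z) * (crossA F z * (nu F z : ℂ)⁻¹ / 2) +
      p.derivative.eval z * (starRingEnd ℂ) (p.eval z) * (1/2) *
        ((starRingEnd ℂ) (crossA F z) * (nu F z : ℂ)⁻¹) +
      p.eval z * (starRingEnd ℂ) (p.eval z) * (1/2) * (ssq (dF F) z * (nu F z : ℂ)⁻¹ -
        (starRingEnd ℂ) (crossA F z) * (crossA F z * ((nu F z : ℂ)⁻¹) ^ 3 / 2))) =
        ((‖p.derivative.eval z‖ ^ 2 * nu F z + w.re * (nu F z)⁻¹ +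
          ‖p.eval z‖ ^ 2 * (Real.sqrt (ssq (dF F) z)) ^ 2 * (nu F z)⁻¹ / 2 -
          ‖p.eval z‖ ^ 2 * ‖crossA F z‖ ^ 2 * (nu F z)⁻¹ ^ 3 / 4 : ℝ) : ℂ) := by
      rw [Real.sq_sqrt (ssq_nonneg _ _)]
      have h1 := Complex.add_conj w
      have h2 : (starRingEnd ℂ) w = (starRingEnd ℂ) (p.eval z) * p.derivative.eval z *
        (starRingEnd ℂ) (crossA F z) := by simp [hw]
      have h3 := mul_conj_norm (p.eval z)
      have h4 := mul_conj_norm (p.derivative.eval z)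
      have h5 := mul_conj_norm (crossA F z)
      rw [h2, hw] at h1
      push_cast at h1 h3 h4 h5 ⊢
      rw [← h3, ← h4, ← h5]
      linear_combination (nu F z : ℂ)⁻¹ / 2 * h1
    rw [e, Complex.ofReal_re]
    have h6 := L3_pt (norm_nonneg (p.eval z)) (norm_nonneg (p.derivative.eval z)) (nu_pos hpos z)
      (Real.sqrt_nonneg (ssq (dF F) z)) (a := ‖crossA F z‖) (x := w.re)
      (by rw [Real.sq_sqrt (ssq_nonneg _ _), nu, Real.sq_sqrt (ssq_nonneg _ _)]
          exact crossA_sq_le F z) (norm_nonneg _)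
      (by refine (Complex.abs_re_le_norm _).trans (le_of_eq ?_)
          simp [hw])
    rwa [Real.sq_sqrt (ssq_nonneg _ _)] at h6 ⊢
  have hSre : ∀ z, (p.eval z * (starRingEnd ℂ) (p.eval z) * (nu F z : ℂ)).re =
      ‖p.eval z‖ ^ 2 * nu F z := by
    intro z; rw [mul_conj_norm, ← Complex.ofReal_mul, Complex.ofReal_re]
  simp only [hSre] at h
  have h7 : 0 ≤ dI (fun z => ‖p.eval z‖ ^ 2 * nu F z) :=
    dI_nonneg fun z _ => mul_nonneg (by positivity) (nu_pos hpos z).le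
  have h8 : cI (fun z => ‖p.eval z‖ ^ 2 * nu F z) ≤ R * nT p := by
    unfold nT
    rw [← cI_const_mul]
    refine cI_mono (by fun_prop) (by fun_prop) fun z hz => ?_
    have := hR z hz.le
    nlinarith [sq_nonneg ‖p.eval z‖]
  have h9 : dI (fun z => (1 - ‖z‖ ^ 2) * (‖p.eval z‖ ^ 2 * ssq (dF F) z / nu F z)) ≤
      dI (fun z => 8 * ((1 - ‖z‖ ^ 2) * (p.derivative.eval z * (starRingEnd ℂ) (p.derivative.eval z) * (nu F z : ℂ) +
      p.eval z * (starRingEnd ℂ) (p.derivative.eval z) * (crossA F z * (nu F z : ℂ)⁻¹ / 2) +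
      p.derivative.eval z * (starRingEnd ℂ) (p.eval z) * (1/2) *
        ((starRingEnd ℂ) (crossA F z) * (nu F z : ℂ)⁻¹) +
      p.eval z * (starRingEnd ℂ) (p.eval z) * (1/2) * (ssq (dF F) z * (nu F z : ℂ)⁻¹ -
        (starRingEnd ℂ) (crossA F z) * (crossA F z * ((nu F z : ℂ)⁻¹) ^ 3 / 2))).re) +
        (8 * R) * ((1 - ‖z‖ ^ 2) * ‖p.derivative.eval z‖ ^ 2)) := by
    refine dI_mono ?_ ?_ fun z hz => ?_
    · simp only [div_eq_mul_inv]; fun_prop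
    · refine Continuous.add ?_ (by fun_prop)
      refine continuous_const.mul (Continuous.mul (by fun_prop) (Complex.continuous_re.comp ?_))
      fun_prop
    · have h10 := hre z
      have h11 := dl_nonneg hz
      have h12 : ‖p.derivative.eval z‖ ^ 2 * nu F z ≤ R * ‖p.derivative.eval z‖ ^ 2 := by
        rw [mul_comm]; exact mul_le_mul_of_nonneg_right (hR z hz) (by positivity)
      nlinarith
  rw [dI_add, dI_const_mul, dI_const_mul] at h9
  · have h13 := LP1 p
    have h14 : 8 * R * dI (fun z => (1 - ‖z‖ ^ 2) * ‖p.derivative.eval z‖ ^ 2) ≤ 8 * R * nT p := by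
      gcongr
    linarith [mul_nonneg hR0 (nT_nonneg p)]
  · refine continuous_const.mul (Continuous.mul (by fun_prop) (Complex.continuous_re.comp ?_))
    fun_prop
  · fun_prop

end

/-- the adjoint Toeplitz operator on polynomials with symbol `∑ a i z^i` -/
def Tz (a : ℕ → ℂ) : Polynomial ℂ →ₗ[ℂ] Polynomial ℂ :=
  Polynomial.lsum fun k => ∑ i ∈ Finset.range (k + 1),
    (starRingEnd ℂ (a i)) • Polynomial.monomial (k - i)

theorem Tz_monomial (a : ℕ → ℂ) (k : ℕ) (c : ℂ) :
    Tz a (Polynomial.monomial k c) = ∑ i ∈ Finset.range (k + 1),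
      Polynomial.monomial (k - i) ((starRingEnd ℂ (a i)) * c) := by
  unfold Tz
  rw [Polynomial.lsum_apply, Polynomial.sum_monomial_index]
  · simp [LinearMap.sum_apply, Polynomial.smul_monomial]
  · simp

theorem divX_monomial_succ (k : ℕ) (c : ℂ) :
    (Polynomial.monomial (k+1) c).divX = Polynomial.monomial k c := by
  rw [← Polynomial.C_mul_X_pow_eq_monomial, Polynomial.divX_C_mul_X_pow]
  simp [Polynomial.C_mul_X_pow_eq_monomial]

theorem Tz_divX (a : ℕ → ℂ) (x : Polynomial ℂ) : Tz a x.divX = (Tz a x).divX := by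
  induction x using Polynomial.induction_on' with
  | add p q hp hq => simp [Polynomial.divX_add, hp, hq]
  | monomial k c =>
    cases k with
    | zero =>
      rw [Tz_monomial]
      simp
    | succ k =>
      rw [divX_monomial_succ, Tz_monomial, Tz_monomial, Finset.sum_range_succ (n := k+1),
        Polynomial.divX_add, ← Polynomial.divX_hom_toFun (p := Finset.sum _ _), map_sum]
      simp only [Polynomial.divX_hom_toFun, Nat.sub_self, Polynomial.monomial_zero_left,
        Polynomial.divX_C, add_zero]
      refine Finset.sum_congr rfl fun i hi => ?_
      have : k + 1 - i = (k - i) + 1 := by have := Finset.mem_range.1 hi; omega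
      rw [this, divX_monomial_succ]

theorem Tz_X_pow_coeff (a : ℕ → ℂ) (m : ℕ) :
    (Tz a (Polynomial.X ^ m)).coeff 0 = starRingEnd ℂ (a m) := by
  rw [← Polynomial.monomial_one_right_eq_X_pow, Tz_monomial, Polynomial.finset_sum_coeff,
    Finset.sum_range_succ, Finset.sum_eq_zero]
  · simp
  · intro i hi
    have := Finset.mem_range.1 hi
    rw [Polynomial.coeff_monomial, if_neg (by omega)]

theorem Tz_congr {a b : ℕ → ℂ} (x : Polynomial ℂ) (h : ∀ i, i ≤ x.natDegree → a i = b i) :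
    Tz a x = Tz b x := by
  unfold Tz
  simp only [Polynomial.lsum_apply]
  refine Finset.sum_congr rfl fun k hk => ?_
  simp only [LinearMap.sum_apply, LinearMap.smul_apply]
  refine Finset.sum_congr rfl fun i hi => ?_
  have h1 := Polynomial.le_natDegree_of_mem_supp k hk
  have := Finset.mem_range.1 hi
  rw [h i (by omega)]

theorem poly_split (f : Polynomial ℂ) (k : ℕ) (e : ℂ) :
    f.eval e = ∑ i ∈ Finset.range k, f.coeff i * e ^ i + e ^ k * (Polynomial.divX^[k] f).eval e := by
  have hc : ∀ k m, (Polynomial.divX^[k] f).coeff m = f.coeff (k + m) := by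
    intro k
    induction k with
    | zero => intro m; simp
    | succ k ih =>
      intro m
      rw [Function.iterate_succ_apply', Polynomial.coeff_divX, ih]
      congr 1; ring
  induction k with
  | zero => simp
  | succ k ih =>
    rw [ih, Finset.sum_range_succ, Function.iterate_succ_apply']
    conv_lhs => rw [← Polynomial.divX_mul_X_add (Polynomial.divX^[k] f)]
    simp [hc]
    ring

theorem circ_id (f x : Polynomial ℂ) : ∃ q : Polynomial ℂ, ∀ e : ℂ, ‖e‖ = 1 →
    f.eval e * (starRingEnd ℂ) (x.eval e) =
      (starRingEnd ℂ) ((Tz f.coeff x).eval e) + e * q.eval e := by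
  induction x using Polynomial.induction_on' with
  | add p q hp hq =>
    obtain ⟨a, ha⟩ := hp
    obtain ⟨b, hb⟩ := hq
    refine ⟨a + b, fun e he => ?_⟩
    have h1 := ha e he
    have h2 := hb e he
    simp only [map_add, Polynomial.eval_add, mul_add, h1, h2]
    ring
  | monomial k c =>
    refine ⟨Polynomial.C (starRingEnd ℂ c) * Polynomial.divX^[k+1] f, fun e he => ?_⟩
    have hee : e * (starRingEnd ℂ) e = 1 := by rw [mul_conj_norm, he]; simp
    have hee' : ∀ m : ℕ, e ^ m * (starRingEnd ℂ) e ^ m = 1 := fun m => by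
      rw [← mul_pow, hee, one_pow]
    rw [Tz_monomial, poly_split f (k+1) e]
    simp only [Polynomial.eval_monomial, map_mul, map_pow, Polynomial.eval_finset_sum, map_sum,
      Complex.conj_conj, Polynomial.eval_mul, Polynomial.eval_C, add_mul, Finset.sum_mul]
    congr 1
    · refine Finset.sum_congr rfl fun i hi => ?_
      have : k = (k - i) + i := by have := Finset.mem_range.1 hi; omega
      have h2 : (starRingEnd ℂ) e ^ k = (starRingEnd ℂ) e ^ (k - i) * (starRingEnd ℂ) e ^ i := by
        rw [← pow_add, ← this]
      rw [h2]
      linear_combination f.coeff i * (starRingEnd ℂ) c * (starRingEnd ℂ) e ^ (k - i) * hee' i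
    · rw [pow_succ]
      linear_combination e * (Polynomial.divX^[k+1] f).eval e * (starRingEnd ℂ) c * hee' k

theorem cI_poly_zero (p : Polynomial ℂ) : cI (fun z => z * p.eval z) = 0 := by
  rw [← stokes_bar (fun z => hasW_poly p z) continuous_const]
  simp [dI]

theorem dI_sumC {ι : Type*} (s : Finset ι) {K : ι → ℂ → ℂ} (hK : ∀ i, Continuous (K i)) :
    dI (fun z => ∑ i ∈ s, K i z) = ∑ i ∈ s, dI (K i) := by
  unfold dI
  simp only [Finset.smul_sum]
  exact integral_finsetSum s fun i _ => dI_int (hK i)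

set_option maxHeartbeats 2000000 in
theorem pair_pt {a a1 w w1 ga g1 d fk r A Dt v R t : ℝ} (ha : 0 ≤ a) (ha1 : 0 ≤ a1) (hw : 0 ≤ w)
    (hw1 : 0 ≤ w1) (hga0 : 0 ≤ ga) (hg10 : 0 ≤ g1) (hd0 : 0 ≤ d) (hfk0 : 0 ≤ fk) (hr : 0 < r)
    (hA0 : 0 ≤ A) (hDt0 : 0 ≤ Dt) (hv : 0 < v) (hR : 1 ≤ R) (ht : 0 < t)
    (hga : ga ≤ r) (hfk : fk ≤ r) (hd2 : d ^ 2 ≤ Dt) (hgd : g1 * d ≤ Dt) (hAd : A * d ≤ Dt * r)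
    (hrR : r ≤ R) (hvr : v ≤ 2 * r) :
    2 * (ga ^ 3 * a * w * (d * fk) * (r⁻¹) ^ 4) + ((3 * ga ^ 2 * g1 * a * w + ga ^ 3 * a1 * w +
      ga ^ 3 * a * w1) * (d * fk) * (r⁻¹) ^ 4 + ga ^ 3 * a * w * (d * fk) * (2 * A * (r⁻¹) ^ 6)) ≤
    t * (14 * R * (a ^ 2 * Dt / v) + a1 ^ 2) +
      t⁻¹ * (w ^ 2 + w1 ^ 2 + 12 * R * (w ^ 2 * Dt / v)) := by
  have hi : 0 < r⁻¹ := inv_pos.2 hr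
  have hri : r * r⁻¹ = 1 := mul_inv_cancel₀ hr.ne'
  set u := r⁻¹ with hu
  have X1 : ga ^ 3 * fk * u ^ 4 ≤ 1 := by
    calc ga ^ 3 * fk * u ^ 4 ≤ r ^ 3 * r * u ^ 4 := by gcongr
      _ = (r * u) ^ 4 := by ring
      _ = 1 := by rw [hri]; simp
  have X2 : ga ^ 2 * fk * u ^ 4 ≤ u := by
    calc ga ^ 2 * fk * u ^ 4 ≤ r ^ 2 * r * u ^ 4 := by gcongr
      _ = (r * u) ^ 3 * u := by ring
      _ = u := by rw [hri]; simp
  have X3 : ga ^ 3 * fk * u ^ 6 ≤ u ^ 2 := by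
    calc ga ^ 3 * fk * u ^ 6 = (ga ^ 3 * fk * u ^ 4) * u ^ 2 := by ring
      _ ≤ 1 * u ^ 2 := by gcongr
      _ = _ := by ring
  have Y1 : 2 * (ga ^ 3 * a * w * (d * fk) * u ^ 4) ≤ 2 * (a * w * d) := by
    calc 2 * (ga ^ 3 * a * w * (d * fk) * u ^ 4) = (ga ^ 3 * fk * u ^ 4) * (2 * (a * w * d)) := by ring
      _ ≤ 1 * (2 * (a * w * d)) := by gcongr
      _ = _ := by ring
  have Y2 : 3 * ga ^ 2 * g1 * a * w * (d * fk) * u ^ 4 ≤ 3 * (a * w * (Dt * u)) := by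
    calc 3 * ga ^ 2 * g1 * a * w * (d * fk) * u ^ 4
        = (ga ^ 2 * fk * u ^ 4) * (3 * (a * w * (g1 * d))) := by ring
      _ ≤ u * (3 * (a * w * Dt)) := by gcongr
      _ = _ := by ring
  have Y3 : ga ^ 3 * a1 * w * (d * fk) * u ^ 4 ≤ a1 * w * d := by
    calc ga ^ 3 * a1 * w * (d * fk) * u ^ 4 = (ga ^ 3 * fk * u ^ 4) * (a1 * w * d) := by ring
      _ ≤ 1 * (a1 * w * d) := by gcongr
      _ = _ := by ring
  have Y4 : ga ^ 3 * a * w1 * (d * fk) * u ^ 4 ≤ a * w1 * d := by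
    calc ga ^ 3 * a * w1 * (d * fk) * u ^ 4 = (ga ^ 3 * fk * u ^ 4) * (a * w1 * d) := by ring
      _ ≤ 1 * (a * w1 * d) := by gcongr
      _ = _ := by ring
  have Y5 : ga ^ 3 * a * w * (d * fk) * (2 * A * u ^ 6) ≤ 2 * (a * w * (Dt * u)) := by
    calc ga ^ 3 * a * w * (d * fk) * (2 * A * u ^ 6)
        = (ga ^ 3 * fk * u ^ 6) * (2 * (a * w * (A * d))) := by ring
      _ ≤ u ^ 2 * (2 * (a * w * (Dt * r))) := by gcongr
      _ = (r * u) * (2 * (a * w * (Dt * u))) := by ring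
      _ = _ := by rw [hri]; ring
  obtain ⟨E, hE⟩ : ∃ E, E = Dt / v := ⟨_, rfl⟩
  have hE0 : 0 ≤ E := hE ▸ div_nonneg hDt0 hv.le
  have hu2 : Dt * u ≤ 2 * E := by
    rw [hE, hu, ← div_eq_mul_inv, ← mul_div_assoc, div_le_div_iff₀ hr hv]
    nlinarith
  have hd3 : d ^ 2 ≤ 2 * R * E := by
    calc d ^ 2 ≤ Dt := hd2
      _ = r * (Dt * u) := by linear_combination -Dt * hri
      _ ≤ R * (2 * E) := by gcongr
      _ = _ := by ring
  have e1 : a ^ 2 * Dt / v = a ^ 2 * E := by rw [hE, mul_div_assoc]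
  have e2 : w ^ 2 * Dt / v = w ^ 2 * E := by rw [hE, mul_div_assoc]
  rw [e1, e2]
  have am : ∀ x y : ℝ, 2 * (x * y) ≤ t * x ^ 2 + t⁻¹ * y ^ 2 := by
    intro x y
    have h1 : 0 ≤ t⁻¹ * (t * x - y) ^ 2 := by positivity
    have h2 : t⁻¹ * (t * x - y) ^ 2 = t * x ^ 2 + t⁻¹ * y ^ 2 - 2 * (x * y) := by
      field_simp
      ring
    linarith
  have am' : ∀ x y : ℝ, 0 ≤ x → 0 ≤ y → x * y ≤ t * x ^ 2 + t⁻¹ * y ^ 2 := by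
    intro x y hx hy
    have := am x y
    have : 0 ≤ x * y := by positivity
    linarith
  have ht' : 0 < t⁻¹ := inv_pos.2 ht
  have Z1 := am (a * d) w
  have Z3 := am' a1 (w * d) ha1 (by positivity)
  have Z4 := am' (a * d) w1 (by positivity) hw1
  have Z2 := am' a w ha hw
  have V1 : t * (a * d) ^ 2 ≤ t * (a ^ 2 * (2 * R * E)) := by rw [mul_pow]; gcongr
  have V3 : t⁻¹ * (w * d) ^ 2 ≤ t⁻¹ * (w ^ 2 * (2 * R * E)) := by rw [mul_pow]; gcongr
  have V2 : a * w * (Dt * u) ≤ (t * a ^ 2 + t⁻¹ * w ^ 2) * (2 * E) := by gcongr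
  have V5 : (t * a ^ 2 + t⁻¹ * w ^ 2) * (2 * E) ≤ (t * a ^ 2 + t⁻¹ * w ^ 2) * (2 * (R * E)) := by
    gcongr; nlinarith
  linarith

/-- family extended by one function -/
def Fo {ι : Type*} (g : Polynomial ℂ) (f : ι → Polynomial ℂ) : Option ι → Polynomial ℂ :=
  fun o => o.elim g f

theorem ssq_Fo {ι : Type*} [Fintype ι] (g : Polynomial ℂ) (f : ι → Polynomial ℂ) (z : ℂ) :
    ssq (Fo g f) z = ‖g.eval z‖ ^ 2 + ssq f z := by
  simp [ssq, Fo, Fintype.sum_option]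

theorem ssq_dFo {ι : Type*} [Fintype ι] (g : Polynomial ℂ) (f : ι → Polynomial ℂ) (z : ℂ) :
    ssq (dF (Fo g f)) z = ‖g.derivative.eval z‖ ^ 2 + ssq (dF f) z := by
  simp [ssq, Fo, dF, Fintype.sum_option]

theorem le_ssq {ι : Type*} [Fintype ι] (f : ι → Polynomial ℂ) (z : ℂ) (j : ι) :
    ‖(f j).eval z‖ ^ 2 ≤ ssq f z :=
  Finset.single_le_sum (f := fun i => ‖(f i).eval z‖ ^ 2) (fun i _ => by positivity)
    (Finset.mem_univ j)

theorem le_nu {ι : Type*} [Fintype ι] (f : ι → Polynomial ℂ) (z : ℂ) (j : ι) :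
    ‖(f j).eval z‖ ≤ nu f z := Real.le_sqrt_of_sq_le (le_ssq f z j)

theorem hasW_pair {ι : Type*} [Fintype ι] (f : ι → Polynomial ℂ) (hpos : ∀ z, 0 < ssq f z)
    (P Q : Polynomial ℂ) (z : ℂ) : HasW (fun z => P.eval z * (starRingEnd ℂ) (Q.eval z) *
      ((ssq f z : ℂ)⁻¹) ^ 2) (P.derivative.eval z * (starRingEnd ℂ) (Q.eval z) *
      ((ssq f z : ℂ)⁻¹) ^ 2 + P.eval z * (starRingEnd ℂ) (Q.eval z) *
      (-2 * crossA f z * ((ssq f z : ℂ)⁻¹) ^ 3))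
      (P.eval z * (starRingEnd ℂ) (Q.derivative.eval z) *
      ((ssq f z : ℂ)⁻¹) ^ 2 + P.eval z * (starRingEnd ℂ) (Q.eval z) *
      (-2 * (starRingEnd ℂ) (crossA f z) * ((ssq f z : ℂ)⁻¹) ^ 3)) z := by
  have hne : (ssq f z : ℂ) ≠ 0 := by exact_mod_cast (hpos z).ne'
  have h1 := ((hasDerivAt_inv hne).pow 2)
  have h2 := ((hasW_poly P z).mul (hasW_poly Q z).conj).mul ((hasW_ssq f z).comp_hol h1)
  refine HasW.congr_d (V := fun z => P.eval z * (starRingEnd ℂ) (Q.eval z) *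
      ((ssq f z : ℂ)⁻¹) ^ 2) h2 ?_ ?_
  · simp only [Pi.pow_apply, map_zero, mul_zero, add_zero, zero_mul, zero_add]
    push_cast
    field_simp
    try ring
  · simp only [Pi.pow_apply, map_zero, mul_zero, add_zero, zero_mul, zero_add]
    push_cast
    field_simp
    try ring

set_option maxHeartbeats 2000000 in
theorem pair_est {ι : Type*} [Fintype ι] (f : ι → Polynomial ℂ) (g : Polynomial ℂ)
    (hpos : ∀ z, 0 < ssq f z) (R : ℝ) (hR1 : 1 ≤ R)
    (hg : ∀ z, ‖z‖ ≤ 1 → ‖g.eval z‖ ^ 2 ≤ ssq f z) (hb : ∀ z, ‖z‖ ≤ 1 → ssq f z ≤ R ^ 2)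
    (φ W : Polynomial ℂ) (j k : ι) (t : ℝ) (ht : 0 < t) :
    ‖dI (fun z => (g ^ 3 * φ * W).eval z * (starRingEnd ℂ) (((f j).derivative * f k).eval z) *
      ((ssq f z : ℂ)⁻¹) ^ 2)‖ ≤ 449 * R ^ 2 * (t * nT φ + t⁻¹ * nT W) := by
  have hcj := Complex.continuous_conj
  have hA := crossA_cont f
  have hS := ssq_cont f
  have hSi : Continuous fun z => ((ssq f z : ℂ)⁻¹) :=
    Continuous.inv₀ (by fun_prop) fun z => by exact_mod_cast (hpos z).ne'
  obtain ⟨P, hP⟩ : ∃ P, P = g ^ 3 * φ * W := ⟨_, rfl⟩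
  obtain ⟨Q, hQ⟩ : ∃ Q, Q = (f j).derivative * f k := ⟨_, rfl⟩
  rw [← hP, ← hQ]
  have hPc := P.continuous
  have hPc' := P.derivative.continuous
  have hQc := Q.continuous
  have hposo : ∀ z, 0 < ssq (Fo g f) z := fun z => by
    rw [ssq_Fo]; have := hpos z; positivity
  have hSo := ssq_cont (Fo g f)
  have hSd := ssq_cont (dF (Fo g f))
  have hno := nu_cont (Fo g f)
  have hnoi : Continuous fun z => (nu (Fo g f) z)⁻¹ := hno.inv₀ fun z => (nu_pos hposo z).ne'
  have hnuo : ∀ z, ‖z‖ ≤ 1 → nu (Fo g f) z ≤ 2 * nu f z := by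
    intro z hz
    have : ssq (Fo g f) z ≤ 2 ^ 2 * ssq f z := by
      rw [ssq_Fo]; have := hg z hz; have := hpos z; linarith
    calc nu (Fo g f) z ≤ Real.sqrt (2 ^ 2 * ssq f z) := Real.sqrt_le_sqrt this
      _ = 2 * nu f z := by rw [Real.sqrt_mul (by norm_num), Real.sqrt_sq (by norm_num)]; rfl
  have hnR : ∀ z, ‖z‖ ≤ 1 → nu f z ≤ R := fun z hz => by
    rw [nu, Real.sqrt_le_left (by linarith)]; exact hb z hz
  rw [first_order (hasW_pair f hpos P Q) (by fun_prop)]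
  refine (dI_norm_le _).trans ?_
  have hφ := φ.continuous
  have hφ' := φ.derivative.continuous
  have hW := W.continuous
  have hW' := W.derivative.continuous
  have step := dI_mono (K := fun z => ‖2 * (1 - z * (starRingEnd ℂ) z) * (P.eval z * (starRingEnd ℂ) (Q.eval z) *
      ((ssq f z : ℂ)⁻¹) ^ 2) +
      z * (1 - z * (starRingEnd ℂ) z) * (P.derivative.eval z * (starRingEnd ℂ) (Q.eval z) *
      ((ssq f z : ℂ)⁻¹) ^ 2 + P.eval z * (starRingEnd ℂ) (Q.eval z) *
      (-2 * crossA f z * ((ssq f z : ℂ)⁻¹) ^ 3))‖)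
    (L := fun z => (t * (14 * R)) * ((1 - ‖z‖ ^ 2) * (‖φ.eval z‖ ^ 2 * ssq (dF (Fo g f)) z / nu (Fo g f) z))
      + (t * ((1 - ‖z‖ ^ 2) * ‖φ.derivative.eval z‖ ^ 2)
      + (t⁻¹ * ((1 - ‖z‖ ^ 2) * ‖W.eval z‖ ^ 2)
      + (t⁻¹ * ((1 - ‖z‖ ^ 2) * ‖W.derivative.eval z‖ ^ 2)
      + (t⁻¹ * (12 * R)) * ((1 - ‖z‖ ^ 2) * (‖W.eval z‖ ^ 2 * ssq (dF (Fo g f)) z / nu (Fo g f) z))))))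
    (by fun_prop) (by simp only [div_eq_mul_inv]; fun_prop) ?_
  · refine step.trans ?_
    rw [dI_add, dI_add, dI_add, dI_add, dI_const_mul, dI_const_mul, dI_const_mul, dI_const_mul,
      dI_const_mul]
    · have hRo : ∀ z, ‖z‖ ≤ 1 → nu (Fo g f) z ≤ 2 * R := fun z hz => by
        have := hnuo z hz; have := hnR z hz; linarith
      have I1 := L3 (Fo g f) hposo (2 * R) hRo φ
      have I2 := L3 (Fo g f) hposo (2 * R) hRo W
      have I3 := LP1 φ
      have I4 := LP2' W
      have I5 := LP1 W
      have ht' : 0 < t⁻¹ := inv_pos.2 ht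
      have n1 := nT_nonneg φ
      have n2 := nT_nonneg W
      have hRR : 1 ≤ R ^ 2 := by nlinarith
      have m1 : 1 * (t * nT φ) ≤ R ^ 2 * (t * nT φ) := by gcongr
      have m2 : 1 * (t⁻¹ * nT W) ≤ R ^ 2 * (t⁻¹ * nT W) := by gcongr
      have m3 : 0 ≤ R ^ 2 * (t⁻¹ * nT W) := by positivity
      calc _ ≤ (t * (14 * R)) * (16 * (2 * R) * nT φ) + (t * nT φ + (t⁻¹ * nT W + (t⁻¹ * nT W +
            (t⁻¹ * (12 * R)) * (16 * (2 * R) * nT W)))) := by gcongr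
        _ ≤ _ := by nlinarith
    all_goals (try simp only [div_eq_mul_inv]); fun_prop
  · intro z hz
    have hdl := dl_nonneg hz
    obtain ⟨dl, hdldef⟩ : ∃ dl : ℝ, dl = 1 - ‖z‖ ^ 2 := ⟨_, rfl⟩
    have hn : (1 - z * (starRingEnd ℂ) z) = (dl : ℂ) := by rw [mul_conj_norm, hdldef]; push_cast; rfl
    have hs : ssq f z = nu f z ^ 2 := (Real.sq_sqrt (hpos z).le).symm
    have hr := nu_pos hpos z
    have hDf : ssq (dF (Fo g f)) z = ‖g.derivative.eval z‖ ^ 2 + ssq (dF f) z := ssq_dFo g f z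
    have hd := le_ssq (dF f) z j
    have hdd0 := ssq_nonneg (dF f) z
    have hss0 := ssq_nonneg f z
    have hAle := crossA_sq_le f z
    have pt := pair_pt (norm_nonneg (φ.eval z)) (norm_nonneg (φ.derivative.eval z))
      (norm_nonneg (W.eval z)) (norm_nonneg (W.derivative.eval z)) (norm_nonneg (g.eval z))
      (norm_nonneg (g.derivative.eval z)) (norm_nonneg ((f j).derivative.eval z))
      (norm_nonneg ((f k).eval z)) hr (norm_nonneg (crossA f z)) (ssq_nonneg (dF (Fo g f)) z)
      (nu_pos hposo z) hR1 ht (Real.le_sqrt_of_sq_le (hg z hz)) (le_nu f z k)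
      (by rw [hDf]; have : ‖(f j).derivative.eval z‖ ^ 2 ≤ ssq (dF f) z := hd
          nlinarith [sq_nonneg ‖g.derivative.eval z‖])
      (by rw [hDf]; have : ‖(f j).derivative.eval z‖ ^ 2 ≤ ssq (dF f) z := hd
          nlinarith [sq_nonneg (‖g.derivative.eval z‖ - ‖(f j).derivative.eval z‖)])
      (by have h1 : ‖(f j).derivative.eval z‖ ^ 2 ≤ ssq (dF f) z := hd
          have h2 : (‖crossA f z‖ * ‖(f j).derivative.eval z‖) ^ 2 ≤ (ssq (dF f) z * nu f z) ^ 2 := by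
            rw [mul_pow]
            calc _ ≤ (ssq (dF f) z * ssq f z) * ssq (dF f) z :=
                mul_le_mul hAle h1 (by positivity) (by positivity)
              _ = _ := by rw [hs]; ring
          have h3 := abs_le_of_sq_le_sq h2 (by positivity)
          refine (le_abs_self _).trans (h3.trans ?_)
          rw [hDf]; gcongr; linarith [sq_nonneg ‖g.derivative.eval z‖])
      (hnR z hz) (hnuo z hz)
    have hPn : ‖P.eval z‖ = ‖g.eval z‖ ^ 3 * ‖φ.eval z‖ * ‖W.eval z‖ := by simp [hP]
    have hQn : ‖Q.eval z‖ = ‖(f j).derivative.eval z‖ * ‖(f k).eval z‖ := by simp [hQ]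
    have hPn' : ‖P.derivative.eval z‖ ≤ 3 * ‖g.eval z‖ ^ 2 * ‖g.derivative.eval z‖ * ‖φ.eval z‖ * ‖W.eval z‖
        + ‖g.eval z‖ ^ 3 * ‖φ.derivative.eval z‖ * ‖W.eval z‖ + ‖g.eval z‖ ^ 3 * ‖φ.eval z‖ * ‖W.derivative.eval z‖ := by
      have : P.derivative.eval z = 3 * g.eval z ^ 2 * g.derivative.eval z * φ.eval z * W.eval z
        + g.eval z ^ 3 * φ.derivative.eval z * W.eval z + g.eval z ^ 3 * φ.eval z * W.derivative.eval z := by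
        simp [hP, Polynomial.derivative_mul, Polynomial.derivative_pow]; ring
      rw [this]
      refine (norm_add₃_le).trans (le_of_eq ?_)
      simp
    have hsi : ‖(ssq f z : ℂ)⁻¹‖ = ((nu f z)⁻¹) ^ 2 := by
      rw [norm_inv, Complex.norm_real, Real.norm_of_nonneg (hpos z).le, hs, inv_pow]
    calc _ ≤ dl * (2 * (‖P.eval z‖ * ‖Q.eval z‖ * ((nu f z)⁻¹) ^ 4) +
          (‖P.derivative.eval z‖ * ‖Q.eval z‖ * ((nu f z)⁻¹) ^ 4 + ‖P.eval z‖ * ‖Q.eval z‖ *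
            (2 * ‖crossA f z‖ * ((nu f z)⁻¹) ^ 6))) := by
          rw [hn]
          have hdl' : 0 ≤ dl := hdldef ▸ hdl
          refine (norm_add_le _ _).trans ?_
          have hkk : ‖P.derivative.eval z * (starRingEnd ℂ) (Q.eval z) *
            ((ssq f z : ℂ)⁻¹) ^ 2 + P.eval z * (starRingEnd ℂ) (Q.eval z) *
            (-2 * crossA f z * ((ssq f z : ℂ)⁻¹) ^ 3)‖ ≤ (‖P.derivative.eval z‖ * ‖Q.eval z‖ * ((nu f z)⁻¹) ^ 4 + ‖P.eval z‖ * ‖Q.eval z‖ *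
            (2 * ‖crossA f z‖ * ((nu f z)⁻¹) ^ 6)) := by
            refine (norm_add_le _ _).trans (le_of_eq ?_)
            simp only [norm_mul, norm_pow, hsi, RCLike.norm_conj, norm_neg, Complex.norm_ofNat]
            ring
          have h1 : ‖2 * (dl:ℂ) * (P.eval z * (starRingEnd ℂ) (Q.eval z) * ((ssq f z : ℂ)⁻¹) ^ 2)‖ =
              dl * (2 * (‖P.eval z‖ * ‖Q.eval z‖ * ((nu f z)⁻¹) ^ 4)) := by
            simp only [norm_mul, norm_pow, hsi, RCLike.norm_conj, Complex.norm_ofNat,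
              Complex.norm_real, Real.norm_of_nonneg hdl']
            ring
          rw [h1, mul_add dl, norm_mul, norm_mul, Complex.norm_real, Real.norm_of_nonneg hdl']
          gcongr
          calc ‖z‖ * dl ≤ 1 * dl := by gcongr
            _ = dl := one_mul _
      _ ≤ dl * (t * (14 * R * (‖φ.eval z‖ ^ 2 * ssq (dF (Fo g f)) z / nu (Fo g f) z) + ‖φ.derivative.eval z‖ ^ 2) +
      t⁻¹ * (‖W.eval z‖ ^ 2 + ‖W.derivative.eval z‖ ^ 2 + 12 * R * (‖W.eval z‖ ^ 2 * ssq (dF (Fo g f)) z / nu (Fo g f) z))) := by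
          have hdl' : 0 ≤ dl := hdldef ▸ hdl
          refine mul_le_mul_of_nonneg_left (le_trans ?_ pt) hdl'
          rw [hPn, hQn]
          gcongr
      _ = _ := by rw [← hdldef]; ring

theorem nT_eq (p : Polynomial ℂ) : (nT p : ℂ) = cI (fun z => ((‖p.eval z‖ ^ 2 : ℝ) : ℂ)) := by
  unfold nT cI
  exact intervalIntegral.integral_ofReal.symm

theorem nT_W {y1 y2 f1 f2 W : Polynomial ℂ} {R : ℝ}
    (h1 : ∀ z, ‖z‖ = 1 → ‖f1.eval z‖ ≤ R) (h2 : ∀ z, ‖z‖ = 1 → ‖f2.eval z‖ ≤ R)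
    (hW : ∀ z, ‖z‖ = 1 → ‖W.eval z‖ ≤ ‖y2.eval z‖ * ‖f1.eval z‖ + ‖y1.eval z‖ * ‖f2.eval z‖) :
    nT W ≤ 2 * R ^ 2 * (nT y1 + nT y2) := by
  have c1 := y1.continuous
  have c2 := y2.continuous
  have c3 := W.continuous
  unfold nT
  rw [← cI_add (by fun_prop) (by fun_prop), ← cI_const_mul]
  refine cI_mono (by fun_prop) (by fun_prop) fun z hz => ?_
  have a1 := h1 z hz
  have a2 := h2 z hz
  have a3 := hW z hz
  have hR : 0 ≤ R := (norm_nonneg _).trans a1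
  have : ‖W.eval z‖ ≤ (‖y1.eval z‖ + ‖y2.eval z‖) * R := by
    calc _ ≤ _ := a3
      _ ≤ ‖y2.eval z‖ * R + ‖y1.eval z‖ * R := by gcongr
      _ = _ := by ring
  calc ‖W.eval z‖ ^ 2 ≤ ((‖y1.eval z‖ + ‖y2.eval z‖) * R) ^ 2 := by gcongr
    _ ≤ _ := by nlinarith [mul_nonneg (sq_nonneg R) (sq_nonneg (‖y1.eval z‖ - ‖y2.eval z‖))]

set_option maxHeartbeats 1000000 in
theorem key1 {ι : Type*} [Fintype ι] (f : ι → Polynomial ℂ) (g : Polynomial ℂ)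
    (hpos : ∀ z, 0 < ssq f z) (R : ℝ) (hR1 : 1 ≤ R)
    (hg : ∀ z, ‖z‖ ≤ 1 → ‖g.eval z‖ ^ 2 ≤ ssq f z) (hb : ∀ z, ‖z‖ ≤ 1 → ssq f z ≤ R ^ 2)
    (x : Polynomial ℂ) (t : ℝ) (ht : 0 < t) :
    nT (Tz (g ^ 3).coeff x) ≤
      R ^ 2 * ∑ j, (t * nT (Tz (g ^ 3).coeff x) + t⁻¹ * nT (Tz (f j).coeff x)) +
      2 * ∑ p : ι × ι, 449 * R ^ 2 * (t * nT (Tz (g ^ 3).coeff x) + t⁻¹ *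
        (2 * R ^ 2 * (nT (Tz (f p.1).coeff x) + nT (Tz (f p.2).coeff x)))) := by
  have hcj := Complex.continuous_conj
  choose q hq using fun j => circ_id (f j) x
  obtain ⟨qh, hqh⟩ := circ_id (g ^ 3) x
  set φ := Tz (g ^ 3).coeff x with hφdef
  set y : ι → Polynomial ℂ := fun j => Tz (f j).coeff x with hy
  have hnR : ∀ z, ‖z‖ ≤ 1 → nu f z ≤ R := fun z hz => by
    rw [nu, Real.sqrt_le_left (by linarith)]; exact hb z hz
  have hS := ssq_cont f
  have hSi : Continuous fun z => ((ssq f z : ℂ)⁻¹) :=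
    Continuous.inv₀ (by fun_prop) fun z => by exact_mod_cast (hpos z).ne'
  have hne : ∀ z, (ssq f z : ℂ) ≠ 0 := fun z => by exact_mod_cast (hpos z).ne'
  have cf := fun j => (f j).continuous
  have cf' := fun j => (f j).derivative.continuous
  have cy := fun j => (y j).continuous
  have cq := fun j => (q j).continuous
  have cφ := φ.continuous
  have cg := g.continuous
  have cA := crossA_cont f
  have hssq : ∀ z, ∑ j, (f j).eval z * (starRingEnd ℂ) ((f j).eval z) = (ssq f z : ℂ) := by
    intro z; simp only [mul_conj_norm, ssq]; push_cast; rfl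
  set v : ι → ℂ → ℂ := fun j z => (g ^ 3 * φ).eval z * (starRingEnd ℂ) ((f j).eval z) * (ssq f z : ℂ)⁻¹ with hv
  set U : ℂ → ℂ := fun z => ∑ j, (g ^ 3 * φ * q j).eval z * (starRingEnd ℂ) ((f j).eval z) * (ssq f z : ℂ)⁻¹ with hU
  have cP := (g ^ 3 * φ).continuous
  have cv : ∀ j, Continuous (v j) := fun j => by simp only [hv]; fun_prop
  set W : ι × ι → Polynomial ℂ := fun p => q p.1 * f p.2 - q p.2 * f p.1 with hWdef
  set K : ι × ι → ℂ → ℂ := fun p z => (g ^ 3 * φ * W p).eval z *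
    (starRingEnd ℂ) (((f p.1).derivative * f p.2).eval z) * ((ssq f z : ℂ)⁻¹) ^ 2 with hK
  have cK : ∀ p, Continuous (K p) := fun p => HasW.continuous (hasW_pair f hpos _ _)
  have hWU : ∀ z, HasW U (∑ j, ((g ^ 3 * φ * q j).derivative.eval z * (starRingEnd ℂ) ((f j).eval z) * (ssq f z : ℂ)⁻¹ +
      (g ^ 3 * φ * q j).eval z * (starRingEnd ℂ) ((f j).eval z) * (-((ssq f z : ℂ) ^ 2)⁻¹ * crossA f z)))
      (∑ p, K p z) z := by
    intro z
    have h := HasW.sum Finset.univ (fun j _ => ((hasW_poly (g ^ 3 * φ * q j) z).mul (hasW_poly (f j) z).conj).mul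
      ((hasW_ssq f z).comp_hol (hasDerivAt_inv (hne z))))
    refine h.congr_d ?_ ?_
    · simp
    · rw [Fintype.sum_prod_type]
      simp only [hK, hWdef, Polynomial.eval_mul, Polynomial.eval_sub, map_mul, zero_mul, zero_add]
      have e1 : (starRingEnd ℂ) (crossA f z) = ∑ k, (starRingEnd ℂ) ((f k).derivative.eval z) * (f k).eval z := by
        simp [crossA]
      have e2 : ∀ j, (g ^ 3).eval z * φ.eval z * (q j).eval z * (starRingEnd ℂ) ((f j).derivative.eval z) * (ssq f z : ℂ)⁻¹ =
          ∑ k, (g ^ 3).eval z * φ.eval z * (q j).eval z * (starRingEnd ℂ) ((f j).derivative.eval z) * ((ssq f z : ℂ)⁻¹)^2 *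
            ((f k).eval z * (starRingEnd ℂ) ((f k).eval z)) := by
        intro j
        rw [← Finset.mul_sum, hssq]
        have := hne z
        field_simp
      simp only [e2, e1, mul_sub, sub_mul, Finset.sum_sub_distrib, Finset.sum_add_distrib, Finset.mul_sum]
      rw [sub_eq_add_neg]
      congr 1
      · refine Finset.sum_congr rfl fun j _ => Finset.sum_congr rfl fun k _ => ?_
        ring
      · rw [Finset.sum_comm, ← Finset.sum_neg_distrib]
        refine Finset.sum_congr rfl fun j _ => ?_
        rw [← Finset.sum_neg_distrib]
        refine Finset.sum_congr rfl fun k _ => ?_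
        rw [inv_pow]
        ring
  have st := stokes_bar hWU (by fun_prop)
  have main : (nT φ : ℂ) = cI (fun z => ∑ j, v j z * (starRingEnd ℂ) ((y j).eval z)) + 2 * ∑ p, dI (K p) := by
    rw [← dI_sumC _ cK, st, ← cI_add (by fun_prop) (by have := HasW.continuous hWU; fun_prop), nT_eq]
    have h0 := cI_poly_zero (qh * φ)
    have : cI (fun z => ((‖φ.eval z‖ ^ 2 : ℝ) : ℂ)) = cI (fun z => ((‖φ.eval z‖ ^ 2 : ℝ) : ℂ)) +
      cI (fun z => z * (qh * φ).eval z) := by rw [h0, add_zero]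
    rw [this, ← cI_add (by fun_prop) (by have := (qh * φ).continuous; fun_prop)]
    refine cI_congr fun z hz => ?_
    have hh := hqh z hz
    calc _ = φ.eval z * ((starRingEnd ℂ) (φ.eval z) + z * qh.eval z) := by
          rw [← mul_conj_norm, Polynomial.eval_mul]; ring
      _ = φ.eval z * (g ^ 3).eval z * (starRingEnd ℂ) (x.eval z) * ((ssq f z : ℂ) * (ssq f z : ℂ)⁻¹) := by
          rw [← hh, mul_inv_cancel₀ (hne z)]; ring
      _ = ∑ j, v j z * ((f j).eval z * (starRingEnd ℂ) (x.eval z)) := by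
          rw [← hssq, Finset.sum_mul, Finset.mul_sum]
          refine Finset.sum_congr rfl fun j _ => ?_
          simp only [hv, Polynomial.eval_mul, hssq]; ring
      _ = _ := by
          simp only [hU]
          rw [Finset.mul_sum, ← Finset.sum_add_distrib]
          refine Finset.sum_congr rfl fun j _ => ?_
          rw [hq j z hz]
          simp only [hv, hy, Polynomial.eval_mul]; ring
  have hn0 := nT_nonneg φ
  have hnorm : nT φ = ‖(nT φ : ℂ)‖ := by rw [Complex.norm_real, Real.norm_of_nonneg hn0]
  refine hnorm.le.trans ?_
  rw [main]
  refine (norm_add_le _ _).trans (add_le_add ?_ ?_)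
  · refine (cI_norm_le _).trans ?_
    have e : R ^ 2 * ∑ j, (t * nT φ + t⁻¹ * nT (y j)) =
        cI (fun z => R ^ 2 * ∑ j, (t * ‖φ.eval z‖ ^ 2 + t⁻¹ * ‖(y j).eval z‖ ^ 2)) := by
      rw [cI_const_mul, cI_sum _ (fun j => by fun_prop)]
      congr 1
      refine Finset.sum_congr rfl fun j _ => ?_
      rw [cI_add (by fun_prop) (by fun_prop), cI_const_mul, cI_const_mul]; rfl
    rw [e]
    refine cI_mono (by fun_prop) (by fun_prop) fun z hz => ?_
    refine (norm_sum_le _ _).trans ?_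
    rw [Finset.mul_sum]
    refine Finset.sum_le_sum fun j _ => ?_
    have hr := nu_pos hpos z
    have hs : ssq f z = nu f z ^ 2 := (Real.sq_sqrt (hpos z).le).symm
    have hvj : ‖v j z‖ ≤ R ^ 2 * ‖φ.eval z‖ := by
      simp only [hv, norm_mul, Polynomial.eval_mul, Polynomial.eval_pow, norm_pow, RCLike.norm_conj,
        norm_inv, Complex.norm_real, Real.norm_of_nonneg (hpos z).le]
      rw [hs, ← div_eq_mul_inv, div_le_iff₀ (by positivity)]
      have g1 : ‖g.eval z‖ ≤ nu f z := Real.le_sqrt_of_sq_le (hg z hz.le)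
      have f1 := le_nu f z j
      have r1 := hnR z hz.le
      calc ‖g.eval z‖ ^ 3 * ‖φ.eval z‖ * ‖(f j).eval z‖ ≤ (nu f z) ^ 3 * ‖φ.eval z‖ * nu f z := by gcongr
        _ = (nu f z) ^ 2 * ‖φ.eval z‖ * nu f z ^ 2 := by ring
        _ ≤ _ := by gcongr
    rw [norm_mul, RCLike.norm_conj]
    have am : ‖φ.eval z‖ * ‖(y j).eval z‖ ≤ t * ‖φ.eval z‖ ^ 2 + t⁻¹ * ‖(y j).eval z‖ ^ 2 := by
      generalize ‖φ.eval z‖ = a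
      generalize ‖(y j).eval z‖ = b
      have h1 : 0 ≤ t⁻¹ * ((t * a - b) ^ 2 + (t * a) ^ 2 + b ^ 2) / 2 := by positivity
      have h2 : t⁻¹ * ((t * a - b) ^ 2 + (t * a) ^ 2 + b ^ 2) / 2 = t * a ^ 2 + t⁻¹ * b ^ 2 - a * b := by
        field_simp
        ring
      linarith
    calc _ ≤ R ^ 2 * ‖φ.eval z‖ * ‖(y j).eval z‖ := by gcongr
      _ = R ^ 2 * (‖φ.eval z‖ * ‖(y j).eval z‖) := by ring
      _ ≤ _ := by gcongr
  · rw [norm_mul, Complex.norm_ofNat]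
    gcongr
    refine (norm_sum_le _ _).trans (Finset.sum_le_sum fun p _ => ?_)
    have h1 := pair_est f g hpos R hR1 hg hb φ (W p) p.1 p.2 t ht
    refine h1.trans ?_
    have h2 : nT (W p) ≤ 2 * R ^ 2 * (nT (y p.1) + nT (y p.2)) := by
      refine nT_W (f1 := f p.1) (f2 := f p.2) (fun z hz => (le_nu f z _).trans (hnR z hz.le))
        (fun z hz => (le_nu f z _).trans (hnR z hz.le)) fun z hz => ?_
      have a1 := hq p.1 z hz
      have a2 := hq p.2 z hz
      have e : z * (W p).eval z = (starRingEnd ℂ) ((y p.2).eval z) * (f p.1).eval z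
          - (starRingEnd ℂ) ((y p.1).eval z) * (f p.2).eval z := by
        simp only [hWdef, Polynomial.eval_sub, Polynomial.eval_mul, hy]
        linear_combination (f p.1).eval z * a2 - (f p.2).eval z * a1
      have e2 := congrArg norm e
      rw [norm_mul, hz, one_mul] at e2
      rw [e2]
      refine (norm_sub_le _ _).trans (le_of_eq ?_)
      simp
    gcongr

theorem key (n : ℕ) (R : ℝ) (hR1 : 1 ≤ R) : ∃ C : ℝ, 0 < C ∧ ∀ (f : Fin n → Polynomial ℂ) (g : Polynomial ℂ),
    (∀ z, 0 < ssq f z) → (∀ z, ‖z‖ ≤ 1 → ‖g.eval z‖ ^ 2 ≤ ssq f z) →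
    (∀ z, ‖z‖ ≤ 1 → ssq f z ≤ R ^ 2) → ∀ x,
    nT (Tz (g ^ 3).coeff x) ≤ C * ∑ j, nT (Tz (f j).coeff x) := by
  obtain ⟨C, hC⟩ : ∃ C : ℝ, C = R ^ 2 * (n + 1) + 2 * 449 * R ^ 2 * (n ^ 2) +
    2 * 449 * R ^ 2 * (4 * R ^ 2 * n) := ⟨_, rfl⟩
  have hCpos : 0 < C := by rw [hC]; positivity
  refine ⟨4 * C ^ 2, by positivity, fun f g hpos hg hb x => ?_⟩
  obtain ⟨a, ha⟩ : ∃ a, a = nT (Tz (g ^ 3).coeff x) := ⟨_, rfl⟩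
  obtain ⟨Y, hY⟩ : ∃ Y, Y = ∑ j, nT (Tz (f j).coeff x) := ⟨_, rfl⟩
  have ha0 : 0 ≤ a := ha ▸ nT_nonneg _
  have hY0 : 0 ≤ Y := hY ▸ Finset.sum_nonneg fun j _ => nT_nonneg _
  rw [← ha, ← hY]
  have h : ∀ t : ℝ, 0 < t → a ≤ C * (t * a + t⁻¹ * Y) := by
    intro t ht
    have h1 := key1 f g hpos R hR1 hg hb x t ht
    have e1 : ∑ j, (t * a + t⁻¹ * nT (Tz (f j).coeff x)) = n * (t * a) + t⁻¹ * Y := by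
      rw [Finset.sum_add_distrib, ← Finset.mul_sum, ← Finset.mul_sum, ← hY]; simp; ring
    have e2 : ∑ p : Fin n × Fin n, 449 * R ^ 2 * (t * a + t⁻¹ *
        (2 * R ^ 2 * (nT (Tz (f p.1).coeff x) + nT (Tz (f p.2).coeff x)))) =
        449 * R ^ 2 * (n ^ 2 * (t * a) + t⁻¹ * (4 * R ^ 2 * n * Y)) := by
      rw [← Finset.mul_sum, Finset.sum_add_distrib, ← Finset.mul_sum, ← Finset.mul_sum, ← Finset.mul_sum,
        Finset.sum_add_distrib, Fintype.sum_prod_type, Fintype.sum_prod_type,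
        Fintype.sum_prod_type]
      simp only [Finset.sum_const, Finset.card_univ, Fintype.card_prod, Fintype.card_fin, nsmul_eq_mul,
        ← Finset.mul_sum, ← hY]
      push_cast
      ring
    rw [← ha, e1, e2] at h1
    have p1 : 0 ≤ t * a := by positivity
    have p2 : 0 ≤ t⁻¹ * Y := by positivity
    have q1 : 0 ≤ R ^ 2 * (t * a) := by positivity
    have q2 : 0 ≤ R ^ 2 * n * (t⁻¹ * Y) := by positivity
    have q3 : 0 ≤ R ^ 2 * n ^ 2 * (t⁻¹ * Y) := by positivity
    have q4 : 0 ≤ R ^ 2 * (4 * R ^ 2 * n) * (t * a) := by positivity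
    rw [hC]
    linarith
  have h2 := h (2 * C)⁻¹ (by positivity)
  rw [inv_inv] at h2
  have e : C * ((2 * C)⁻¹ * a + 2 * C * Y) = a / 2 + 2 * C ^ 2 * Y := by field_simp
  rw [e] at h2
  linarith

theorem contr_ext {X P Q : Type*} [AddCommGroup X] [Module ℂ X] [NormedAddCommGroup P]
    [InnerProductSpace ℂ P] [CompleteSpace P] [NormedAddCommGroup Q] [InnerProductSpace ℂ Q]
    [CompleteSpace Q] (α : X →ₗ[ℂ] P) (β : X →ₗ[ℂ] Q) (h : ∀ x, ‖β x‖ ≤ ‖α x‖) :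
    ∃ V : P →L[ℂ] Q, (∀ p, ‖V p‖ ≤ ‖p‖) ∧ ∀ x, V (α x) = β x := by
  set M := (LinearMap.range α).topologicalClosure with hM
  have hMc : IsClosed (M : Set P) := Submodule.isClosed_topologicalClosure _
  haveI : CompleteSpace M := hMc.completeSpace_coe
  let e : X →ₗ[ℂ] M := α.codRestrict M fun x => Submodule.le_topologicalClosure _ ⟨x, rfl⟩
  have he : ∀ x, ((e x : M) : P) = α x := fun x => rfl
  have hd : DenseRange e := by
    intro m
    rw [closure_subtype]
    have h1 : ((↑) '' (Set.range e) : Set P) = (LinearMap.range α : Set P) := by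
      ext p; constructor
      · rintro ⟨_, ⟨x, rfl⟩, rfl⟩; exact ⟨x, rfl⟩
      · rintro ⟨x, rfl⟩; exact ⟨e x, ⟨x, rfl⟩, rfl⟩
    rw [h1]
    exact m.2
  have hn : ∀ x, ‖β x‖ ≤ 1 * ‖e x‖ := fun x => by rw [one_mul]; exact h x
  refine ⟨(β.extendOfNorm e).comp M.orthogonalProjectionOnto, fun p => ?_, fun x => ?_⟩
  · have h1 := LinearMap.norm_extendOfNorm_apply_le hd 1 hn (M.orthogonalProjectionOnto p)
    rw [one_mul] at h1
    exact h1.trans (M.norm_orthogonalProjectionOnto_apply_le p)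
  · have h2 : M.orthogonalProjectionOnto (α x) = e x :=
      M.orthogonalProjectionOnto_mem_subspace_eq_self (e x)
    rw [ContinuousLinearMap.comp_apply, h2]
    exact LinearMap.extendOfNorm_eq hd ⟨1, hn⟩ x

set_option maxHeartbeats 1000000 in
theorem realiz {X 𝓗 E : Type*} [AddCommGroup X] [Module ℂ X] [NormedAddCommGroup 𝓗]
    [InnerProductSpace ℂ 𝓗] [CompleteSpace 𝓗] [NormedAddCommGroup E] [InnerProductSpace ℂ E]
    [CompleteSpace E] (D : X →ₗ[ℂ] 𝓗) (S : X →ₗ[ℂ] X) (a : X →ₗ[ℂ] E) (b : X →ₗ[ℂ] ℂ)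
    (h : ∀ x, ‖D x‖ ^ 2 + ‖b x‖ ^ 2 = ‖D (S x)‖ ^ 2 + ‖a x‖ ^ 2) :
    ∃ γ : ℕ → E →ₗ[ℂ] ℂ, (∀ w : ℂ, ‖w‖ < 1 → ∀ u, ∃ o : ℂ, HasSum (fun k => w ^ k * γ k u) o ∧
      ‖o‖ ≤ ‖u‖) ∧ ∀ m x, (S ^ (m + 1)) x = 0 →
        b x = ∑ k ∈ Finset.range (m + 1), γ k (a ((S ^ k) x)) := by
  let ι1 : X →ₗ[ℂ] WithLp 2 (𝓗 × E) :=
    (WithLp.linearEquiv 2 ℂ (𝓗 × E)).symm.toLinearMap.comp ((D.comp S).prod a)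
  let ι2 : X →ₗ[ℂ] WithLp 2 (𝓗 × ℂ) :=
    (WithLp.linearEquiv 2 ℂ (𝓗 × ℂ)).symm.toLinearMap.comp (D.prod b)
  have e1 : ∀ x, ι1 x = WithLp.toLp 2 (D (S x), a x) := fun x => rfl
  have e2 : ∀ x, ι2 x = WithLp.toLp 2 (D x, b x) := fun x => rfl
  obtain ⟨V, hV, hVe⟩ := contr_ext ι1 ι2 (fun x => by
    refine le_of_sq_le_sq ?_ (norm_nonneg _)
    rw [WithLp.prod_norm_sq_eq_of_L2, WithLp.prod_norm_sq_eq_of_L2]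
    exact (h x).le)
  let A : 𝓗 →L[ℂ] 𝓗 := (WithLp.fstL 2 ℂ 𝓗 ℂ).comp (V.comp
    (((WithLp.prodContinuousLinearEquiv 2 ℂ 𝓗 E).symm : 𝓗 × E →L[ℂ] WithLp 2 (𝓗 × E)).comp
      (ContinuousLinearMap.inl ℂ 𝓗 E)))
  let B : E →L[ℂ] 𝓗 := (WithLp.fstL 2 ℂ 𝓗 ℂ).comp (V.comp
    (((WithLp.prodContinuousLinearEquiv 2 ℂ 𝓗 E).symm : 𝓗 × E →L[ℂ] WithLp 2 (𝓗 × E)).comp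
      (ContinuousLinearMap.inr ℂ 𝓗 E)))
  let c : 𝓗 →L[ℂ] ℂ := (WithLp.sndL 2 ℂ 𝓗 ℂ).comp (V.comp
    (((WithLp.prodContinuousLinearEquiv 2 ℂ 𝓗 E).symm : 𝓗 × E →L[ℂ] WithLp 2 (𝓗 × E)).comp
      (ContinuousLinearMap.inl ℂ 𝓗 E)))
  let d : E →L[ℂ] ℂ := (WithLp.sndL 2 ℂ 𝓗 ℂ).comp (V.comp
    (((WithLp.prodContinuousLinearEquiv 2 ℂ 𝓗 E).symm : 𝓗 × E →L[ℂ] WithLp 2 (𝓗 × E)).comp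
      (ContinuousLinearMap.inr ℂ 𝓗 E)))
  have eA : ∀ η, A η = (V (WithLp.toLp 2 (η, 0))).fst := fun η => rfl
  have eB : ∀ u, B u = (V (WithLp.toLp 2 (0, u))).fst := fun u => rfl
  have ec : ∀ η, c η = (V (WithLp.toLp 2 (η, 0))).snd := fun η => rfl
  have ed : ∀ u, d u = (V (WithLp.toLp 2 (0, u))).snd := fun u => rfl
  have spl : ∀ η u, V (WithLp.toLp 2 (η, u)) = V (WithLp.toLp 2 (η, 0)) + V (WithLp.toLp 2 (0, u)) := by
    intro η u
    rw [← map_add, ← WithLp.toLp_add]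
    simp
  have s1 : ∀ η u, (V (WithLp.toLp 2 (η, u))).fst = A η + B u := by
    intro η u; rw [spl]; rfl
  have s2 : ∀ η u, (V (WithLp.toLp 2 (η, u))).snd = c η + d u := by
    intro η u; rw [spl]; rfl
  have bnd : ∀ η u, ‖A η + B u‖ ^ 2 + ‖c η + d u‖ ^ 2 ≤ ‖η‖ ^ 2 + ‖u‖ ^ 2 := by
    intro η u
    have := hV (WithLp.toLp 2 (η, u))
    have h2 : ‖V (WithLp.toLp 2 (η, u))‖ ^ 2 ≤ ‖(WithLp.toLp 2 (η, u) : WithLp 2 (𝓗 × E))‖ ^ 2 := by gcongr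
    rw [WithLp.prod_norm_sq_eq_of_L2, WithLp.prod_norm_sq_eq_of_L2, s1, s2] at h2
    exact h2
  have rec1 : ∀ x, D x = A (D (S x)) + B (a x) := by
    intro x
    have := s1 (D (S x)) (a x)
    rw [← e1, hVe] at this
    exact this
  have rec2 : ∀ x, b x = c (D (S x)) + d (a x) := by
    intro x
    have := s2 (D (S x)) (a x)
    rw [← e1, hVe] at this
    exact this
  clear_value A B c d
  clear s1 s2 spl eA eB ec ed
  have hA1 : ∀ η, ‖A η‖ ≤ ‖η‖ := by
    intro η
    have := bnd η 0
    simp only [map_zero, add_zero, norm_zero] at this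
    refine le_of_sq_le_sq ?_ (norm_nonneg _)
    nlinarith [sq_nonneg ‖c η‖]
  have hAk : ∀ k η, ‖(A ^ k) η‖ ≤ ‖η‖ := by
    intro k
    induction k with
    | zero => intro η; simp
    | succ k ih => intro η; rw [pow_succ']; exact (hA1 _).trans (ih η)
  let γ : ℕ → E →ₗ[ℂ] ℂ := fun k => match k with
    | 0 => d.toLinearMap
    | (k + 1) => (c.comp ((A ^ k).comp B)).toLinearMap
  have γ0 : ∀ u, γ 0 u = d u := fun u => rfl
  have γs : ∀ k u, γ (k + 1) u = c ((A ^ k) (B u)) := fun k u => rfl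
  refine ⟨γ, fun w hw u => ?_, fun m x hx => ?_⟩
  · have hsum : Summable (fun k : ℕ => w ^ k • (A ^ k) (B u)) := by
      refine Summable.of_norm_bounded (g := fun k : ℕ => ‖w‖ ^ k * ‖B u‖)
        ((summable_geometric_of_lt_one (norm_nonneg _) hw).mul_right _) fun k => ?_
      rw [norm_smul, norm_pow]
      gcongr
      exact hAk k _
    obtain ⟨η, hη⟩ := hsum
    have hfix : A (w • η) + B u = η := by
      have h1 : HasSum (fun k : ℕ => w ^ (k + 1) • (A ^ (k + 1)) (B u)) (w • A η) := by
        have := (A.hasSum hη).const_smul w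
        convert this using 2 with k
        rw [map_smul, smul_smul, pow_succ', pow_succ']
        rfl
      have h2 := (hasSum_nat_add_iff (f := fun k : ℕ => w ^ k • (A ^ k) (B u)) 1).1 h1
      simp only [Finset.range_one, Finset.sum_singleton, pow_zero, one_smul] at h2
      rw [map_smul]
      exact h2.unique hη
    refine ⟨c (w • η) + d u, ?_, ?_⟩
    · have h1 : HasSum (fun k : ℕ => w ^ (k + 1) * γ (k + 1) u) (c (w • η)) := by
        have := (c.hasSum hη).mul_left w
        rw [map_smul, smul_eq_mul]
        have hfe : (fun k : ℕ => w ^ (k + 1) * γ (k + 1) u) =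
            fun i : ℕ => w * c (w ^ i • (A ^ i) (B u)) := by
          funext k
          rw [map_smul, smul_eq_mul, γs, pow_succ']
          ring
        rw [hfe]
        exact this
      have h2 := (hasSum_nat_add_iff (f := fun k : ℕ => w ^ k * γ k u) 1).1 h1
      simpa [γ0] using h2
    · have h1 := bnd (w • η) u
      rw [hfix] at h1
      have h2 : ‖w • η‖ ≤ ‖η‖ := by
        rw [norm_smul]
        exact mul_le_of_le_one_left (norm_nonneg _) hw.le
      have h3 : ‖w • η‖ ^ 2 ≤ ‖η‖ ^ 2 := by gcongr
      refine le_of_sq_le_sq ?_ (norm_nonneg _)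
      linarith
  · have hD : ∀ m y, (S ^ m) y = 0 → D y = ∑ k ∈ Finset.range m, (A ^ k) (B (a ((S ^ k) y))) := by
      intro m
      induction m with
      | zero => intro y hy; simp at hy; simp [hy]
      | succ m ih =>
        intro y hy
        rw [rec1 y, ih (S y) (by rw [pow_succ] at hy; exact hy), Finset.sum_range_succ', map_sum]
        congr 1
        refine Finset.sum_congr rfl fun k _ => ?_
        rw [pow_succ' A, pow_succ S]
        rfl
    rw [rec2 x, hD m (S x) (by rw [pow_succ] at hx; exact hx), Finset.sum_range_succ', map_sum]
    congr 1

theorem realiz_core {X E : Type*} [AddCommGroup X] [Module ℂ X]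
    [NormedAddCommGroup E] [InnerProductSpace ℂ E]
    [CompleteSpace E] (cd : PreInnerProductSpace.Core ℂ X) (S : X →ₗ[ℂ] X) (a : X →ₗ[ℂ] E)
    (b : X →ₗ[ℂ] ℂ)
    (h : ∀ x, (cd.inner x x).re + ‖b x‖ ^ 2 = (cd.inner (S x) (S x)).re + ‖a x‖ ^ 2) :
    ∃ γ : ℕ → E →ₗ[ℂ] ℂ, (∀ w : ℂ, ‖w‖ < 1 → ∀ u, ∃ o : ℂ, HasSum (fun k => w ^ k * γ k u) o ∧
      ‖o‖ ≤ ‖u‖) ∧ ∀ m x, (S ^ (m + 1)) x = 0 →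
        b x = ∑ k ∈ Finset.range (m + 1), γ k (a ((S ^ k) x)) := by
  letI i1 : SeminormedAddCommGroup X := InnerProductSpace.Core.toSeminormedAddCommGroup (c := cd)
  letI i2 : InnerProductSpace ℂ X := InnerProductSpace.ofCore cd
  have hn : ∀ x : X, ‖x‖ ^ 2 = (cd.inner x x).re := fun x =>
    InnerProductSpace.norm_sq_eq_re_inner (𝕜 := ℂ) x
  refine realiz (𝓗 := UniformSpace.Completion X)
    (UniformSpace.Completion.toComplL (𝕜 := ℂ) (E := X)).toLinearMap S a b fun x => ?_
  have e : ∀ y : X, ‖(UniformSpace.Completion.toComplL (𝕜 := ℂ) (E := X)).toLinearMap y‖ = ‖y‖ :=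
    fun y => UniformSpace.Completion.norm_coe y
  rw [e, e, hn, hn]
  exact h x

/-- inner product of polynomials on the circle -/
def ip (p q : Polynomial ℂ) : ℂ :=
  ((2 * π : ℝ) : ℂ)⁻¹ * cI (fun z => (starRingEnd ℂ) (p.eval z) * q.eval z)

theorem ip_add (p p' q : Polynomial ℂ) : ip (p + p') q = ip p q + ip p' q := by
  unfold ip
  have c1 := p.continuous
  have c2 := p'.continuous
  have c3 := q.continuous
  rw [← mul_add, ← cI_add (by fun_prop) (by fun_prop)]
  simp only [Polynomial.eval_add, map_add, add_mul]

theorem cI_const_mulC (c : ℂ) (K : ℂ → ℂ) : cI (fun z => c * K z) = c * cI K := by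
  unfold cI
  rw [← intervalIntegral.integral_const_mul]

theorem ip_smul (c : ℂ) (p q : Polynomial ℂ) : ip (c • p) q = (starRingEnd ℂ) c * ip p q := by
  unfold ip
  rw [mul_left_comm, ← cI_const_mulC ((starRingEnd ℂ) c)]
  simp only [Polynomial.eval_smul, smul_eq_mul, map_mul, mul_assoc]

theorem ip_conj (p q : Polynomial ℂ) : (starRingEnd ℂ) (ip q p) = ip p q := by
  unfold ip
  rw [map_mul, ← cI_conj, map_inv₀, Complex.conj_ofReal]
  congr 2
  funext z
  rw [map_mul, Complex.conj_conj, mul_comm]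

theorem ip_self (p : Polynomial ℂ) : ip p p = (((2 * π)⁻¹ * nT p : ℝ) : ℂ) := by
  unfold ip
  rw [Complex.ofReal_mul (2 * π)⁻¹, nT_eq, Complex.ofReal_inv]
  congr 2
  funext z
  rw [mul_comm, mul_conj_norm]

theorem ip_divX (y : Polynomial ℂ) :
    (2 * π)⁻¹ * nT y = (2 * π)⁻¹ * nT y.divX + ‖y.coeff 0‖ ^ 2 := by
  have h0 : nT y = nT y.divX + (2 * π) * ‖y.coeff 0‖ ^ 2 := by
    have hc : (2 * π) * ‖y.coeff 0‖ ^ 2 = cI (fun _ => ‖y.coeff 0‖ ^ 2) := by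
      simp [cI]
    have c1 := y.continuous
    have c2 := y.divX.continuous
    have hz : cI (fun z => 2 * (z * (Polynomial.C ((starRingEnd ℂ) (y.coeff 0)) * y.divX).eval z).re) = 0 := by
      have := cI_poly_zero (Polynomial.C ((starRingEnd ℂ) (y.coeff 0)) * y.divX)
      have c4 := (Polynomial.C ((starRingEnd ℂ) (y.coeff 0)) * y.divX).continuous
      rw [cI_const_mul, ← cI_re (by fun_prop), this]
      simp
    have c4 := (Polynomial.C ((starRingEnd ℂ) (y.coeff 0)) * y.divX).continuous
    have c5 : Continuous fun z : ℂ => 2 * (z * (Polynomial.C ((starRingEnd ℂ) (y.coeff 0)) * y.divX).eval z).re :=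
      continuous_const.mul (Complex.continuous_re.comp (by fun_prop))
    rw [hc, ← add_zero (nT y.divX + _), ← hz]
    unfold nT
    rw [← cI_add (by fun_prop) (by fun_prop), ← cI_add (by fun_prop) c5]
    refine cI_congr fun z hz => ?_
    have e1 : y.eval z = z * y.divX.eval z + y.coeff 0 := by
      conv_lhs => rw [← Polynomial.divX_mul_X_add y]
      rw [Polynomial.eval_add, Polynomial.eval_mul, Polynomial.eval_X, Polynomial.eval_C, mul_comm]
    rw [e1, ← Complex.normSq_eq_norm_sq, Complex.normSq_add, Complex.normSq_mul,
      Complex.normSq_eq_norm_sq z, hz, Complex.normSq_eq_norm_sq, Complex.normSq_eq_norm_sq]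
    simp only [Polynomial.eval_mul, Polynomial.eval_C]
    ring_nf
  rw [h0, mul_add, ← mul_assoc, inv_mul_cancel₀ (by positivity), one_mul]

/-- `divX` as a linear map -/
def dX : Polynomial ℂ →ₗ[ℂ] Polynomial ℂ where
  toFun := Polynomial.divX
  map_add' p q := Polynomial.divX_add
  map_smul' c p := by
    ext k
    simp [Polynomial.coeff_divX]

theorem dX_pow (m : ℕ) : ∀ k, k ≤ m → (dX ^ k) (Polynomial.X ^ m) = Polynomial.X ^ (m - k) := by
  intro k
  induction k with
  | zero => intro _; simp
  | succ k ih =>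
    intro hk
    rw [pow_succ', Module.End.mul_apply, ih (by omega)]
    obtain ⟨l, hl⟩ : ∃ l, m - k = l + 1 := ⟨m - k - 1, by omega⟩
    have : m - (k + 1) = l := by omega
    rw [this, hl]
    change (Polynomial.X ^ (l + 1)).divX = _
    ext i
    simp [Polynomial.coeff_divX, Polynomial.coeff_X_pow]

theorem dX_pow_zero (m : ℕ) : (dX ^ (m + 1)) (Polynomial.X ^ m) = 0 := by
  rw [pow_succ', Module.End.mul_apply, dX_pow m m le_rfl]
  change Polynomial.divX _ = 0
  simp

theorem leech {n : ℕ} (F : Fin n → ℕ → ℂ) (H : ℕ → ℂ) (C : ℝ) (hC : 0 < C)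
    (h : ∀ x, nT (Tz H x) ≤ C ^ 2 * ∑ j, nT (Tz (F j) x)) :
    ∃ G : Fin n → ℕ → ℂ, (∀ m, H m = ∑ j, ∑ k ∈ Finset.range (m + 1), G j k * F j (m - k)) ∧
      ∀ j (z : ℂ), ‖z‖ < 1 → ∃ o : ℂ, HasSum (fun k => G j k * z ^ k) o ∧ ‖o‖ ≤ C := by
  let Q : Polynomial ℂ → Polynomial ℂ → ℂ := fun x y =>
    ((C ^ 2 : ℝ) : ℂ) * ∑ j, ip (Tz (F j) x) (Tz (F j) y) - ip (Tz H x) (Tz H y)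
  have hQ : ∀ x, (Q x x).re = C ^ 2 * ∑ j, (2 * π)⁻¹ * nT (Tz (F j) x) - (2 * π)⁻¹ * nT (Tz H x) := by
    intro x
    have : Q x x = ((C ^ 2 * ∑ j, (2 * π)⁻¹ * nT (Tz (F j) x) - (2 * π)⁻¹ * nT (Tz H x) : ℝ) : ℂ) := by
      simp only [Q, ip_self]
      push_cast
      rfl
    rw [this, Complex.ofReal_re]
  let cd : PreInnerProductSpace.Core ℂ (Polynomial ℂ) :=
    { inner := Q
      conj_inner_symm := fun x y => by
        simp only [Q, map_sub, map_mul, map_sum, ip_conj, Complex.conj_ofReal]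
      re_inner_nonneg := fun x => by
        change 0 ≤ (Q x x).re
        rw [hQ, ← Finset.mul_sum]
        have := h x
        have h2 : 0 ≤ (2 * π)⁻¹ * (C ^ 2 * ∑ j, nT (Tz (F j) x) - nT (Tz H x)) :=
          mul_nonneg (by positivity) (by linarith)
        linarith
      add_left := fun x y z => by
        simp only [Q, map_add, ip_add, Finset.sum_add_distrib]
        ring
      smul_left := fun x y r => by
        simp only [Q, map_smul, ip_smul, ← Finset.mul_sum]
        ring }
  let a : Polynomial ℂ →ₗ[ℂ] EuclideanSpace ℂ (Fin n) :=
    (WithLp.linearEquiv 2 ℂ (Fin n → ℂ)).symm.toLinearMap.comp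
      (LinearMap.pi fun j => (C : ℂ) • ((Polynomial.lcoeff ℂ 0).comp (Tz (F j))))
  let b : Polynomial ℂ →ₗ[ℂ] ℂ := (Polynomial.lcoeff ℂ 0).comp (Tz H)
  have ea : ∀ x, a x = WithLp.toLp 2 (fun j => (C : ℂ) * (Tz (F j) x).coeff 0) := fun x => rfl
  have eb : ∀ x, b x = (Tz H x).coeff 0 := fun x => rfl
  obtain ⟨γ, h1, h2⟩ := realiz_core cd dX a b (fun x => by
    change (Q x x).re + _ = (Q x.divX x.divX).re + _
    rw [hQ, hQ, ea, eb, EuclideanSpace.norm_sq_eq]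
    simp only [Tz_divX, ip_divX (Tz (F _) x), ip_divX (Tz H x), Finset.sum_add_distrib, norm_mul,
      mul_pow, ← Finset.mul_sum, Complex.norm_real, Real.norm_eq_abs, sq_abs]
    ring)
  have hγ : ∀ k (v : Fin n → ℂ), γ k (WithLp.toLp 2 v) = ∑ j, v j * γ k (EuclideanSpace.single j 1) := by
    intro k v
    have : (WithLp.toLp 2 v : EuclideanSpace ℂ (Fin n)) = ∑ j, v j • EuclideanSpace.single j (1 : ℂ) := by
      ext i
      simp [Finset.sum_apply, Pi.single_apply]
    rw [this, map_sum]
    simp only [map_smul, smul_eq_mul]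
  refine ⟨fun j k => (starRingEnd ℂ) (C * γ k (EuclideanSpace.single j 1)), fun m => ?_, fun j z hz => ?_⟩
  · have h3 := h2 m (Polynomial.X ^ m) (dX_pow_zero m)
    rw [eb, Tz_X_pow_coeff] at h3
    rw [← Complex.conj_conj (H m), h3, map_sum, Finset.sum_comm]
    refine Finset.sum_congr rfl fun k hk => ?_
    rw [dX_pow m k (by simp at hk; omega), ea, hγ, map_sum]
    refine Finset.sum_congr rfl fun j _ => ?_
    rw [Tz_X_pow_coeff]
    simp only [map_mul, Complex.conj_conj]
    ring
  · obtain ⟨o, ho, hb⟩ := h1 ((starRingEnd ℂ) z) (by rwa [RCLike.norm_conj]) (EuclideanSpace.single j 1)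
    refine ⟨C * (starRingEnd ℂ) o, ?_, ?_⟩
    · have h4 : HasSum (fun k => (starRingEnd ℂ) ((starRingEnd ℂ) z ^ k * γ k (EuclideanSpace.single j 1)))
          ((starRingEnd ℂ) o) := Complex.hasSum_conj'.2 (by simpa using ho)
      have h5 := h4.mul_left (C : ℂ)
      refine (congrArg (fun q : ℕ → ℂ => HasSum q (C * (starRingEnd ℂ) o)) (funext fun k => ?_)).mp h5
      simp only [map_mul, map_pow, Complex.conj_conj, Complex.conj_ofReal]
      ring
    · rw [norm_mul, RCLike.norm_conj, Complex.norm_real, Real.norm_of_nonneg hC.le]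
      have : ‖(EuclideanSpace.single j 1 : EuclideanSpace ℂ (Fin n))‖ = 1 := by simp
      rw [this] at hb
      exact mul_le_of_le_one_right hC.le hb

/-- `φ` is the power series of `h` on the unit disc -/
def PSer (φ : PowerSeries ℂ) (h : ℂ → ℂ) : Prop :=
  ∀ z : ℂ, ‖z‖ < 1 → HasSum (fun k => PowerSeries.coeff k φ * z ^ k) (h z)

theorem exists_pser {h : ℂ → ℂ} (hd : DifferentiableOn ℂ h (Metric.ball 0 1)) :
    ∃ φ, PSer φ h := by
  refine ⟨PowerSeries.mk fun k => ((k.factorial : ℂ))⁻¹ * iteratedDeriv k h 0, fun z hz => ?_⟩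
  have := Complex.hasSum_taylorSeries_on_ball hd (z := z) (by simpa using hz)
  refine (congrArg (fun q : ℕ → ℂ => HasSum q (h z)) (funext fun k => ?_)).mp this
  simp only [PowerSeries.coeff_mk, smul_eq_mul, sub_zero]
  ring

theorem PSer.mul {φ ψ : PowerSeries ℂ} {h k : ℂ → ℂ} (hφ : PSer φ h) (hψ : PSer ψ k) :
    PSer (φ * ψ) (fun z => h z * k z) := by
  intro z hz
  have h1 := hφ z hz
  have h2 := hψ z hz
  have s1 := h1.summable.norm
  have s2 := h2.summable.norm
  have e := tsum_mul_tsum_eq_tsum_sum_antidiagonal_of_summable_norm s1 s2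
  rw [h1.tsum_eq, h2.tsum_eq] at e
  have s3 := (summable_norm_sum_mul_antidiagonal_of_summable_norm s1 s2).of_norm
  have h3 := s3.hasSum
  rw [← e] at h3
  refine (congrArg (fun q : ℕ → ℂ => HasSum q (h z * k z)) (funext fun m => ?_)).mp h3
  rw [PowerSeries.coeff_mul, Finset.sum_mul]
  refine Finset.sum_congr rfl fun p hp => ?_
  rw [← Finset.HasAntidiagonal.mem_antidiagonal.1 hp, pow_add]
  ring

theorem PSer.unif {φ : PowerSeries ℂ} {h : ℂ → ℂ} (hφ : PSer φ h) {r : ℝ} (hr0 : 0 ≤ r) (hr1 : r < 1)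
    {δ : ℝ} (hδ : 0 < δ) : ∀ᶠ N in atTop, ∀ z : ℂ, ‖z‖ ≤ 1 →
      ‖(PowerSeries.trunc N (PowerSeries.rescale (r : ℂ) φ)).eval z - h (r * z)‖ ≤ δ := by
  have hs := (hφ r (by rwa [Complex.norm_real, Real.norm_of_nonneg hr0])).summable.norm
  have := tendstoUniformlyOn_tsum_nat (f := fun k z => PowerSeries.coeff k φ * ((r : ℂ) * z) ^ k)
    hs (s := Metric.closedBall 0 1) (fun k z hz => by
      rw [mul_pow, ← mul_assoc, norm_mul, norm_pow]
      exact mul_le_of_le_one_right (norm_nonneg _) (pow_le_one₀ (norm_nonneg _) (by simpa using hz)))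
  rw [Metric.tendstoUniformlyOn_iff] at this
  filter_upwards [this δ hδ] with N hN z hz
  have h2 := hN z (by simpa using hz)
  have h3 : ‖(r : ℂ) * z‖ < 1 := by
    rw [norm_mul, Complex.norm_real, Real.norm_of_nonneg hr0]
    exact (mul_le_of_le_one_right hr0 hz).trans_lt hr1
  rw [(hφ _ h3).tsum_eq, dist_comm, dist_eq_norm] at h2
  refine le_of_eq_of_le ?_ h2.le
  congr 2
  rw [Polynomial.eval, PowerSeries.eval₂_trunc_eq_sum_range]
  refine Finset.sum_congr rfl fun k _ => ?_
  rw [PowerSeries.coeff_rescale, RingHom.id_apply, mul_pow]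
  ring

theorem PSer.diff {φ : PowerSeries ℂ} {h : ℂ → ℂ} (hφ : PSer φ h) :
    DifferentiableOn ℂ h (Metric.ball 0 1) := by
  intro z hz
  have hz' : ‖z‖ < 1 := by simpa using hz
  obtain ⟨ρ, h1, h2⟩ := exists_between hz'
  have hρ : 0 ≤ ρ := (norm_nonneg z).trans h1.le
  have hs := (hφ ρ (by rwa [Complex.norm_real, Real.norm_of_nonneg hρ])).summable.norm
  have hd := Complex.differentiableOn_tsum_of_summable_norm
    (F := fun k w => PowerSeries.coeff k φ * w ^ k) hs (U := Metric.ball 0 ρ)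
    (fun k => by fun_prop) Metric.isOpen_ball (fun k w hw => by
      have hw' : ‖w‖ < ρ := by simpa using hw
      rw [norm_mul, norm_mul, norm_pow, norm_pow, Complex.norm_real, Real.norm_of_nonneg hρ]
      gcongr)
  have hzm : z ∈ Metric.ball (0 : ℂ) ρ := by simpa using h1
  have hd1 := (hd.differentiableAt (Metric.isOpen_ball.mem_nhds hzm))
  have he : h =ᶠ[nhds z] (fun w => ∑' k, PowerSeries.coeff k φ * w ^ k) := by
    filter_upwards [Metric.isOpen_ball.mem_nhds hz] with w hw
    exact (hφ w (by simpa using hw)).tsum_eq.symm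
  exact (he.differentiableAt_iff.2 hd1).differentiableWithinAt

theorem Tz_const (e : ℂ) (x : Polynomial ℂ) :
    Tz (Polynomial.C e).coeff x = (starRingEnd ℂ) e • x := by
  induction x using Polynomial.induction_on' with
  | add p q hp hq => rw [map_add, hp, hq, smul_add]
  | monomial k c =>
    rw [Tz_monomial, Finset.sum_range_succ']
    simp [Polynomial.coeff_C, Polynomial.smul_monomial]

theorem nT_smul (e : ℂ) (x : Polynomial ℂ) : nT (e • x) = ‖e‖ ^ 2 * nT x := by
  unfold nT
  rw [← cI_const_mul]
  simp only [Polynomial.eval_smul, smul_eq_mul, norm_mul, mul_pow]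

theorem Tz_joint (a : ℕ → ℂ) (x : Polynomial ℂ) :
    Continuous fun p : ℝ × ℂ => (Tz (fun i => (p.1 : ℂ) ^ i * a i) x).eval p.2 := by
  induction x using Polynomial.induction_on' with
  | add p q hp hq => simp only [map_add, Polynomial.eval_add]; exact hp.add hq
  | monomial k c =>
    simp only [Tz_monomial, Polynomial.eval_finset_sum, Polynomial.eval_monomial, map_mul, map_pow,
      Complex.conj_ofReal]
    fun_prop

theorem nT_cont (a : ℕ → ℂ) (x : Polynomial ℂ) :
    Continuous fun r : ℝ => nT (Tz (fun i => (r : ℂ) ^ i * a i) x) := by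
  unfold nT cI
  apply intervalIntegral.continuous_parametric_intervalIntegral_of_continuous'
  have h := Tz_joint a x
  have h2 : Continuous fun p : ℝ × ℝ => ((p.1, Complex.exp (I * p.2)) : ℝ × ℂ) := by fun_prop
  exact (h.comp h2).norm.pow 2

theorem sq_close {a b : ℂ} {δ M : ℝ} (h : ‖a - b‖ ≤ δ) (hδ1 : δ ≤ 1) (hb : ‖b‖ ≤ M) :
    ‖a‖ ^ 2 ≤ ‖b‖ ^ 2 + δ * (2 * M + 1) ∧ ‖b‖ ^ 2 ≤ ‖a‖ ^ 2 + δ * (2 * M + 1) ∧ ‖a‖ ≤ M + 1 := by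
  have h1 : ‖a‖ ≤ ‖b‖ + δ := by
    have := norm_add_le (a - b) b
    rw [sub_add_cancel] at this
    linarith
  have h2 : ‖b‖ ≤ ‖a‖ + δ := by
    have := norm_add_le (b - a) a
    rw [sub_add_cancel, norm_sub_rev] at this
    linarith
  have hδ0 : 0 ≤ δ := (norm_nonneg _).trans h
  have := norm_nonneg a
  have := norm_nonneg b
  refine ⟨?_, ?_, by linarith⟩
  · nlinarith
  · rcases le_total ‖b‖ ‖a‖ with h3 | h3
    · nlinarith
    · nlinarith

theorem step_r (n : ℕ) (M : ℝ) (hM : 0 ≤ M) : ∃ C : ℝ, 0 < C ∧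
    ∀ (g : ℂ → ℂ) (f : Fin n → ℂ → ℂ) (φ : PowerSeries ℂ) (ψ : Fin n → PowerSeries ℂ),
    PSer φ g → (∀ j, PSer (ψ j) (f j)) → (∀ z, ‖z‖ < 1 → ‖g z‖ ≤ M) →
    (∀ j z, ‖z‖ < 1 → ‖f j z‖ ≤ M) → (∀ z, ‖z‖ < 1 → ‖g z‖ ^ 2 ≤ ∑ j, ‖f j z‖ ^ 2) →
    ∀ r : ℝ, 0 ≤ r → r < 1 → ∀ ε : ℝ, 0 < ε → ε ≤ 1 → ∀ x,
    nT (Tz (fun i => (r : ℂ) ^ i * PowerSeries.coeff i (φ ^ 3)) x) ≤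
      C * (ε ^ 2 * nT x + ∑ j, nT (Tz (fun i => (r : ℂ) ^ i * PowerSeries.coeff i (ψ j)) x)) := by
  have hR1 : 1 ≤ (n : ℝ) * (M + 1) ^ 2 + 1 := by
    have : 0 ≤ (n : ℝ) * (M + 1) ^ 2 := by positivity
    linarith
  obtain ⟨C, hC, hk⟩ := key (n + 1) ((n : ℝ) * (M + 1) ^ 2 + 1) hR1
  refine ⟨C, hC, fun g f φ ψ hφ hψ bg bf hs r hr0 hr1 ε hε hε1 x => ?_⟩
  obtain ⟨δ, hδ, hδ1, hδ2⟩ : ∃ δ : ℝ, 0 < δ ∧ δ ≤ 1 ∧ δ * (2 * M + 1) * (n + 1) ≤ ε ^ 2 := by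
    refine ⟨min 1 (ε ^ 2 / ((2 * M + 1) * (n + 1))), lt_min one_pos (by positivity), min_le_left _ _, ?_⟩
    have := min_le_right 1 (ε ^ 2 / ((2 * M + 1) * ((n : ℝ) + 1)))
    rw [mul_assoc]
    rwa [le_div_iff₀ (by positivity)] at this
  have ev := (hφ.unif hr0 hr1 hδ).and ((Filter.eventually_all.2 fun j => (hψ j).unif hr0 hr1 hδ).and
    (eventually_gt_atTop x.natDegree))
  obtain ⟨N, h1, h2, h3⟩ := ev.exists
  have hrz : ∀ z : ℂ, ‖z‖ ≤ 1 → ‖(r : ℂ) * z‖ < 1 := by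
    intro z hz
    rw [norm_mul, Complex.norm_real, Real.norm_of_nonneg hr0]
    exact (mul_le_of_le_one_right hr0 hz).trans_lt hr1
  let P : Fin (n + 1) → Polynomial ℂ := Fin.cons (Polynomial.C (ε : ℂ))
    (fun j => PowerSeries.trunc N (PowerSeries.rescale (r : ℂ) (ψ j)))
  have hP : ∀ z, ssq P z = ε ^ 2 +
      ∑ j, ‖(PowerSeries.trunc N (PowerSeries.rescale (r : ℂ) (ψ j))).eval z‖ ^ 2 := by
    intro z
    unfold ssq
    rw [Fin.sum_univ_succ]
    simp only [P, Fin.cons_zero, Fin.cons_succ, Polynomial.eval_C, Complex.norm_real,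
      Real.norm_of_nonneg hε.le]
  have key1 := hk P (PowerSeries.trunc N (PowerSeries.rescale (r : ℂ) φ)) (fun z => by
      rw [hP]; positivity) (fun z hz => by
      rw [hP]
      have a1 := (sq_close (h1 z hz) hδ1 (bg _ (hrz z hz))).1
      have a2 := hs _ (hrz z hz)
      have a3 : ∑ j, ‖f j (r * z)‖ ^ 2 ≤ ∑ j : Fin n,
          (‖(PowerSeries.trunc N (PowerSeries.rescale (r : ℂ) (ψ j))).eval z‖ ^ 2 + δ * (2 * M + 1)) :=
        Finset.sum_le_sum fun j _ => (sq_close (h2 j z hz) hδ1 (bf j _ (hrz z hz))).2.1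
      rw [Finset.sum_add_distrib, Finset.sum_const, Finset.card_univ, Fintype.card_fin,
        nsmul_eq_mul] at a3
      linarith) (fun z hz => by
      rw [hP]
      have a3 : ∑ j, ‖(PowerSeries.trunc N (PowerSeries.rescale (r : ℂ) (ψ j))).eval z‖ ^ 2 ≤
          ∑ j : Fin n, (M + 1) ^ 2 :=
        Finset.sum_le_sum fun j _ =>
          pow_le_pow_left₀ (norm_nonneg _) (sq_close (h2 j z hz) hδ1 (bf j _ (hrz z hz))).2.2 2
      rw [Finset.sum_const, Finset.card_univ, Fintype.card_fin, nsmul_eq_mul] at a3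
      have a4 : ε ^ 2 ≤ 1 := pow_le_one₀ hε.le hε1
      nlinarith) x
  rw [Fin.sum_univ_succ] at key1
  simp only [P, Fin.cons_zero, Fin.cons_succ, Tz_const, nT_smul, Complex.conj_ofReal,
    Complex.norm_real, Real.norm_of_nonneg hε.le] at key1
  have e1 : Tz ((PowerSeries.trunc N (PowerSeries.rescale (r : ℂ) φ)) ^ 3).coeff x =
      Tz (fun i => (r : ℂ) ^ i * PowerSeries.coeff i (φ ^ 3)) x := by
    refine Tz_congr x fun i hi => ?_
    have hiN : i < N := by omega
    have t := congrArg (fun p => Polynomial.coeff p i)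
      (PowerSeries.trunc_trunc_pow (PowerSeries.rescale (r : ℂ) φ) N 3)
    simp only [PowerSeries.coeff_trunc, if_pos hiN] at t
    rw [← map_pow, PowerSeries.coeff_rescale, ← Polynomial.coe_pow, Polynomial.coeff_coe] at t
    exact t
  have e2 : ∀ j, Tz (PowerSeries.trunc N (PowerSeries.rescale (r : ℂ) (ψ j))).coeff x =
      Tz (fun i => (r : ℂ) ^ i * PowerSeries.coeff i (ψ j)) x := by
    intro j
    refine Tz_congr x fun i hi => ?_
    have hiN : i < N := by omega
    rw [PowerSeries.coeff_trunc, if_pos hiN, PowerSeries.coeff_rescale]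
  simp only [e1, e2] at key1
  exact key1

theorem step_1 (n : ℕ) (M : ℝ) (hM : 0 ≤ M) : ∃ C : ℝ, 0 < C ∧
    ∀ (g : ℂ → ℂ) (f : Fin n → ℂ → ℂ) (φ : PowerSeries ℂ) (ψ : Fin n → PowerSeries ℂ),
    PSer φ g → (∀ j, PSer (ψ j) (f j)) → (∀ z, ‖z‖ < 1 → ‖g z‖ ≤ M) →
    (∀ j z, ‖z‖ < 1 → ‖f j z‖ ≤ M) → (∀ z, ‖z‖ < 1 → ‖g z‖ ^ 2 ≤ ∑ j, ‖f j z‖ ^ 2) → ∀ x,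
    nT (Tz (fun i => PowerSeries.coeff i (φ ^ 3)) x) ≤
      C * ∑ j, nT (Tz (fun i => PowerSeries.coeff i (ψ j)) x) := by
  obtain ⟨C, hC, hk⟩ := step_r n M hM
  refine ⟨C, hC, fun g f φ ψ hφ hψ bg bf hs x => ?_⟩
  have A : ∀ r : ℝ, 0 ≤ r → r < 1 → nT (Tz (fun i => (r : ℂ) ^ i * PowerSeries.coeff i (φ ^ 3)) x) ≤
      C * ∑ j, nT (Tz (fun i => (r : ℂ) ^ i * PowerSeries.coeff i (ψ j)) x) := by
    intro r hr0 hr1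
    have hc : Continuous fun ε : ℝ => C * (ε ^ 2 * nT x +
        ∑ j, nT (Tz (fun i => (r : ℂ) ^ i * PowerSeries.coeff i (ψ j)) x)) := by fun_prop
    have ht := (hc.tendsto 0).mono_left (nhdsWithin_le_nhds (s := Set.Ioi 0))
    have := ge_of_tendsto ht (b := nT (Tz (fun i => (r : ℂ) ^ i * PowerSeries.coeff i (φ ^ 3)) x)) (by
      filter_upwards [Ioo_mem_nhdsGT (zero_lt_one (α := ℝ))] with ε hε
      exact hk g f φ ψ hφ hψ bg bf hs r hr0 hr1 ε hε.1 hε.2.le x)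
    simpa using this
  have c1 := nT_cont (fun i => PowerSeries.coeff i (φ ^ 3)) x
  have c2 : Continuous fun r : ℝ =>
      C * ∑ j, nT (Tz (fun i => (r : ℂ) ^ i * PowerSeries.coeff i (ψ j)) x) :=
    continuous_const.mul (continuous_finsetSum _ fun j _ => nT_cont (fun i => PowerSeries.coeff i (ψ j)) x)
  have t1 := (c1.tendsto 1).mono_left (nhdsWithin_le_nhds (s := Set.Iio 1))
  have t2 := (c2.tendsto 1).mono_left (nhdsWithin_le_nhds (s := Set.Iio 1))
  have := le_of_tendsto_of_tendsto t1 t2 (by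
    filter_upwards [Ioo_mem_nhdsLT (zero_lt_one (α := ℝ))] with r hr
    exact A r hr.1.le hr.2)
  simpa using this

theorem wolff_aux (n : ℕ) (g : ℂ → ℂ) (f : Fin n → ℂ → ℂ)
    (hg : DifferentiableOn ℂ g (Metric.ball 0 1)) (hf : ∀ j, DifferentiableOn ℂ (f j) (Metric.ball 0 1))
    (M : ℝ) (hM : 0 ≤ M) (bg : ∀ z, ‖z‖ < 1 → ‖g z‖ ≤ M) (bf : ∀ j z, ‖z‖ < 1 → ‖f j z‖ ≤ M)
    (hs : ∀ z, ‖z‖ < 1 → ‖g z‖ ^ 2 ≤ ∑ j, ‖f j z‖ ^ 2) :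
    ∃ G : Fin n → ℂ → ℂ, (∀ j, DifferentiableOn ℂ (G j) (Metric.ball 0 1) ∧
      ∃ M', ∀ z, ‖z‖ < 1 → ‖G j z‖ ≤ M') ∧ ∀ z, ‖z‖ < 1 → ∑ j, f j z * G j z = (g z) ^ 3 := by
  obtain ⟨φ, hφ⟩ := exists_pser hg
  choose ψ hψ using fun j => exists_pser (hf j)
  obtain ⟨C, hC, hk⟩ := step_1 n M hM
  have hk' := hk g f φ ψ hφ hψ bg bf hs
  obtain ⟨c, hc1, hc2⟩ := leech (fun j i => PowerSeries.coeff i (ψ j))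
    (fun i => PowerSeries.coeff i (φ ^ 3)) (Real.sqrt C) (Real.sqrt_pos.2 hC)
    (by rw [Real.sq_sqrt hC.le]; exact hk')
  choose! G hG hGb using hc2
  have hps : ∀ j, PSer (PowerSeries.mk (c j)) (G j) := fun j z hz => by
    simp only [PowerSeries.coeff_mk]
    exact hG j z hz
  refine ⟨G, fun j => ⟨(hps j).diff, _, hGb j⟩, fun z hz => ?_⟩
  have h3 : PSer (φ ^ 3) (fun z => g z * g z * g z) := by
    rw [pow_succ, pow_two]
    exact (hφ.mul hφ).mul hφ
  have h4 : φ ^ 3 = ∑ j, PowerSeries.mk (c j) * ψ j := by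
    ext m
    rw [hc1 m, map_sum]
    refine Finset.sum_congr rfl fun j _ => ?_
    rw [PowerSeries.coeff_mul, Finset.Nat.sum_antidiagonal_eq_sum_range_succ_mk]
    simp only [PowerSeries.coeff_mk]
  have h5 : HasSum (fun k => PowerSeries.coeff k (φ ^ 3) * z ^ k) (∑ j, G j z * f j z) := by
    have := hasSum_sum (s := Finset.univ) fun j _ => ((hps j).mul (hψ j)) z hz
    refine (congrArg (fun q : ℕ → ℂ => HasSum q (∑ j, G j z * f j z)) (funext fun k => ?_)).mp this
    rw [h4, map_sum, Finset.sum_mul]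
  have h6 : ∑ j, G j z * f j z = g z * g z * g z := h5.unique (h3 z hz)
  rw [show (g z) ^ 3 = g z * g z * g z by ring, ← h6]
  exact Finset.sum_congr rfl fun j _ => mul_comm _ _

/-- **Wolff's theorem.** If `g, f₁, …, fₙ ∈ H^∞(𝔻)` satisfy
`|g(z)| ≤ (∑ⱼ |fⱼ(z)|²)^{1/2}` on the disk, then `g³` belongs to the ideal generated by
`f₁, …, fₙ` in `H^∞(𝔻)`. -/
theorem wolff_theorem (n : ℕ) (g : ℂ → ℂ) (f : Fin n → ℂ → ℂ)
    (hg : MemHinf g) (hf : ∀ j, MemHinf (f j))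
    (hsize : ∀ z ∈ unitDisk, ‖g z‖ ≤ Real.sqrt (∑ j, ‖f j z‖ ^ 2)) :
    ∃ G : Fin n → ℂ → ℂ, (∀ j, MemHinf (G j)) ∧
      ∀ z ∈ unitDisk, ∑ j, f j z * G j z = (g z) ^ 3 := by
  obtain ⟨hgd, Mg, hMg⟩ := hg
  have hd : ∀ z : ℂ, ‖z‖ < 1 → z ∈ unitDisk := fun z hz => by
    unfold unitDisk
    simpa using hz
  have hd' : ∀ z ∈ unitDisk, ‖z‖ < 1 := fun z hz => by
    unfold unitDisk at hz
    simpa using hz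
  choose hfd Mf hMf using hf
  have hle : ∀ j, |Mf j| ≤ ∑ i, |Mf i| := fun j =>
    Finset.single_le_sum (f := fun i => |Mf i|) (fun i _ => abs_nonneg _) (Finset.mem_univ j)
  have hs0 : 0 ≤ ∑ i, |Mf i| := Finset.sum_nonneg fun i _ => abs_nonneg _
  obtain ⟨G, h1, h2⟩ := wolff_aux n g f hgd hfd (|Mg| + ∑ i, |Mf i|)
    (add_nonneg (abs_nonneg _) hs0)
    (fun z hz => by
      have a1 := hMg z (hd z hz)
      have a2 := le_abs_self Mg
      linarith)
    (fun j z hz => by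
      have a1 := hMf j z (hd z hz)
      have a2 := le_abs_self (Mf j)
      have a3 := hle j
      have a4 := abs_nonneg Mg
      linarith)
    (fun z hz => by
      have a1 := hsize z (hd z hz)
      have a2 : (0 : ℝ) ≤ ∑ j, ‖f j z‖ ^ 2 := Finset.sum_nonneg fun j _ => by positivity
      rw [← Real.sq_sqrt a2]
      exact pow_le_pow_left₀ (norm_nonneg _) a1 2)
  refine ⟨G, fun j => ⟨(h1 j).1, ?_⟩, fun z hz => h2 z (hd' z hz)⟩
  obtain ⟨M', hM'⟩ := (h1 j).2
  exact ⟨M', fun z hz => hM' z (hd' z hz)⟩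

end
end

section
/- Let 0 < p < 1 and let g, f_1, ..., f_n be analytic functions on a neighborhood of the closed unit disk with f_1, ..., f_n ∈ Q_p, Σ_{l=1}^n |f_l(z)|^2 > 0 on D, and |g(z)| ≤ (Σ_{l=1}^n |f_l(z)|^2)^{1/2} for all z ∈ D. Define ψ_j = g f̄_j / Σ_{l=1}^n |f_l|^2. Then for all 1 ≤ j, k ≤ n, the function G = g ψ_j ∂ψ_k/∂z̄ satisfies |G(z)|^2 ≤ C Σ_{l=1}^n |f'_l(z)|^2 for an absolute constant C, and consequently |G(z)|^2 (1 - |z|^2)^p dA(z) is a p-Carleson measure on D. -/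
open MeasureTheory Complex Metric Set Filter
open scoped ENNReal Real

noncomputable section

/-- `F` is real differentiable at `z` with `∂F/∂z̄ = d`. -/
def HasWB (F : ℂ → ℂ) (d z : ℂ) : Prop :=
  ∃ L : ℂ →L[ℝ] ℂ, HasFDerivAt F L z ∧ (L 1 + Complex.I * L Complex.I) / 2 = d

theorem HasWB.eq {F : ℂ → ℂ} {d z : ℂ} (h : HasWB F d z) : wderivBar F z = d := by
  obtain ⟨L, hL, h⟩ := h
  rw [wderivBar, hL.fderiv, h]

theorem HasWB.holo {F : ℂ → ℂ} {z : ℂ} (h : DifferentiableAt ℂ F z) : HasWB F 0 z := by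
  refine ⟨_, h.hasDerivAt.hasFDerivAt.restrictScalars ℝ, ?_⟩
  simp
  linear_combination (deriv F z) * Complex.I_mul_I

theorem HasWB.conj_holo {F : ℂ → ℂ} {z : ℂ} (h : DifferentiableAt ℂ F z) :
    HasWB (fun w => (starRingEnd ℂ) (F w)) ((starRingEnd ℂ) (deriv F z)) z := by
  refine ⟨_, (Complex.conjCLE.toContinuousLinearMap.hasFDerivAt (x := F z)).comp z
    (h.hasDerivAt.hasFDerivAt.restrictScalars ℝ), ?_⟩
  simp
  linear_combination (-(starRingEnd ℂ) (deriv F z) / 2) * Complex.I_mul_I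

theorem HasWB.mul {F G : ℂ → ℂ} {a b z : ℂ} (hF : HasWB F a z) (hG : HasWB G b z) :
    HasWB (fun w => F w * G w) (a * G z + F z * b) z := by
  obtain ⟨L, hL, rfl⟩ := hF
  obtain ⟨M, hM, rfl⟩ := hG
  refine ⟨_, hL.mul hM, ?_⟩
  simp
  ring

theorem HasWB.sum {n : ℕ} {F : Fin n → ℂ → ℂ} {a : Fin n → ℂ} {z : ℂ}
    (hF : ∀ l, HasWB (F l) (a l) z) :
    HasWB (fun w => ∑ l, F l w) (∑ l, a l) z := by
  choose L hL h using hF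
  refine ⟨_, HasFDerivAt.fun_sum (fun l _ => hL l), ?_⟩
  simp only [← h, ← Finset.sum_div, Finset.sum_add_distrib, Finset.mul_sum,
    _root_.sum_apply]

theorem HasWB.div {F G : ℂ → ℂ} {a b z : ℂ} (hF : HasWB F a z) (hG : HasWB G b z)
    (h0 : G z ≠ 0) :
    HasWB (fun w => F w / G w) ((a * G z - F z * b) / (G z) ^ 2) z := by
  obtain ⟨L, hL, rfl⟩ := hF
  obtain ⟨M, hM, rfl⟩ := hG
  have hi := ((hasDerivAt_inv h0).hasFDerivAt.restrictScalars ℝ).comp z hM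
  refine ⟨_, ((hL.mul hi).congr_of_eventuallyEq
    (Filter.Eventually.of_forall fun w => div_eq_mul_inv _ _)), ?_⟩
  simp
  field_simp
  ring

theorem wbar_psi {n : ℕ} {g : ℂ → ℂ} {f : Fin n → ℂ → ℂ} {z : ℂ}
    (hg : DifferentiableAt ℂ g z) (hf : ∀ l, DifferentiableAt ℂ (f l) z)
    (hS : 0 < ∑ l, ‖f l z‖ ^ 2) (k : Fin n) :
    wderivBar (fun w => g w * (starRingEnd ℂ) (f k w) / ((∑ l, ‖f l w‖ ^ 2 : ℝ) : ℂ)) z =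
      g z * ((starRingEnd ℂ) (deriv (f k) z) * ((∑ l, ‖f l z‖ ^ 2 : ℝ) : ℂ) -
        (starRingEnd ℂ) (f k z) * ∑ l, f l z * (starRingEnd ℂ) (deriv (f l) z)) /
          ((∑ l, ‖f l z‖ ^ 2 : ℝ) : ℂ) ^ 2 := by
  have hSeq : ∀ w, ((∑ l, ‖f l w‖ ^ 2 : ℝ) : ℂ) = ∑ l, f l w * (starRingEnd ℂ) (f l w) := by
    intro w
    push_cast
    exact Finset.sum_congr rfl fun l _ => (Complex.mul_conj' _).symm
  have hne : ((∑ l, ‖f l z‖ ^ 2 : ℝ) : ℂ) ≠ 0 := by exact_mod_cast hS.ne'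
  have h1 := (HasWB.holo hg).mul (HasWB.conj_holo (hf k))
  have h2 := HasWB.sum (fun l => (HasWB.holo (hf l)).mul (HasWB.conj_holo (hf l)))
  simp only [hSeq] at hne ⊢
  rw [(h1.div h2 hne).eq]
  simp
  ring

theorem norm_bound {n : ℕ} (u v : Fin n → ℂ) (c : ℂ) (hS : 0 < ∑ l, ‖u l‖ ^ 2)
    (hc : ‖c‖ ≤ Real.sqrt (∑ l, ‖u l‖ ^ 2)) (j k : Fin n) :
    ‖c * (c * (starRingEnd ℂ) (u j) / ((∑ l, ‖u l‖ ^ 2 : ℝ) : ℂ)) *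
      (c * ((starRingEnd ℂ) (v k) * ((∑ l, ‖u l‖ ^ 2 : ℝ) : ℂ) -
        (starRingEnd ℂ) (u k) * ∑ l, u l * (starRingEnd ℂ) (v l)) /
          ((∑ l, ‖u l‖ ^ 2 : ℝ) : ℂ) ^ 2)‖ ^ 2 ≤ 4 * ∑ l, ‖v l‖ ^ 2 := by
  have hu : ∀ i, ‖u i‖ ≤ Real.sqrt (∑ l, ‖u l‖ ^ 2) := fun i =>
    Real.le_sqrt_of_sq_le (Finset.single_le_sum (f := fun l => ‖u l‖ ^ 2)
      (fun l _ => sq_nonneg _) (Finset.mem_univ i))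
  have hv : ∀ i, ‖v i‖ ≤ Real.sqrt (∑ l, ‖v l‖ ^ 2) := fun i =>
    Real.le_sqrt_of_sq_le (Finset.single_le_sum (f := fun l => ‖v l‖ ^ 2)
      (fun l _ => sq_nonneg _) (Finset.mem_univ i))
  have hcs : ‖∑ l, u l * (starRingEnd ℂ) (v l)‖ ≤
      Real.sqrt (∑ l, ‖u l‖ ^ 2) * Real.sqrt (∑ l, ‖v l‖ ^ 2) := by
    refine (norm_sum_le _ _).trans ?_
    simp only [norm_mul, RCLike.norm_conj]
    exact Real.sum_mul_le_sqrt_mul_sqrt _ _ _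
  have hsS := Real.sq_sqrt hS.le
  have hsD := Real.sq_sqrt (Finset.sum_nonneg (fun l (_ : l ∈ Finset.univ) => sq_nonneg ‖v l‖))
  have hs0 := Real.sqrt_pos.2 hS
  have hd0 := Real.sqrt_nonneg (∑ l, ‖v l‖ ^ 2)
  set S := ∑ l, ‖u l‖ ^ 2
  set D := ∑ l, ‖v l‖ ^ 2
  set s := Real.sqrt S
  set d := Real.sqrt D
  set T := ∑ l, u l * (starRingEnd ℂ) (v l)
  have hE : ‖(starRingEnd ℂ) (v k) * (S : ℂ) - (starRingEnd ℂ) (u k) * T‖ ≤ 2 * d * s ^ 2 := by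
    refine (norm_sub_le _ _).trans ?_
    rw [norm_mul, norm_mul, RCLike.norm_conj, RCLike.norm_conj, Complex.norm_real,
      Real.norm_of_nonneg hS.le, ← hsS]
    have h1 : ‖v k‖ * s ^ 2 ≤ d * s ^ 2 := by gcongr; exact hv k
    have h2 : ‖u k‖ * ‖T‖ ≤ s * (s * d) := by gcongr; exact hu k
    nlinarith
  have key : ‖c * (c * (starRingEnd ℂ) (u j) / (S : ℂ)) *
      (c * ((starRingEnd ℂ) (v k) * (S : ℂ) - (starRingEnd ℂ) (u k) * T) / (S : ℂ) ^ 2)‖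
      ≤ 2 * d := by
    rw [norm_mul, norm_mul, norm_div, norm_div, norm_mul, norm_mul, norm_pow, RCLike.norm_conj,
      Complex.norm_real, Real.norm_of_nonneg hS.le, ← hsS]
    calc _ ≤ s * (s * s / s ^ 2) * (s * (2 * d * s ^ 2) / (s ^ 2) ^ 2) := by
          gcongr
          · exact hu j
          · rw [hsS] at hE ⊢; exact hE
      _ = 2 * d := by field_simp
  calc _ ≤ (2 * d) ^ 2 := by gcongr
    _ = 4 * D := by rw [← hsD]; ring

theorem moebius_identity (a z : ℂ) (h : 1 - (starRingEnd ℂ) a * z ≠ 0) :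
    1 - ‖moebius a z‖ ^ 2 =
      (1 - ‖a‖ ^ 2) * (1 - ‖z‖ ^ 2) / ‖1 - (starRingEnd ℂ) a * z‖ ^ 2 := by
  have h' : ‖1 - (starRingEnd ℂ) a * z‖ ^ 2 ≠ 0 := by simpa using h
  rw [moebius, norm_div, div_pow, eq_div_iff h', sub_mul, div_mul_cancel₀ _ h']
  simp only [← Complex.normSq_eq_norm_sq, Complex.normSq_apply]
  simp
  ring

theorem box_weight {θ h : ℝ} (hh : h ∈ Set.Ioc (0 : ℝ) 1) {z : ℂ} (hz : z ∈ carlesonBox θ h) :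
    1 - ‖z‖ ^ 2 ≤ ((2 + Real.pi) ^ 2 * h) *
      (1 - ‖moebius ((1 - h : ℝ) * Complex.exp (Complex.I * θ)) z‖ ^ 2) := by
  obtain ⟨h1, h2, t, ht, hzt⟩ := hz
  obtain ⟨h0, hle⟩ := hh
  set e := Complex.exp (Complex.I * θ) with he
  set a : ℂ := (1 - h : ℝ) * e with ha
  have hen : ‖e‖ = 1 := by rw [he, mul_comm]; exact Complex.norm_exp_ofReal_mul_I θ
  have han : ‖a‖ = 1 - h := by
    rw [ha, norm_mul, hen, Complex.norm_real, Real.norm_of_nonneg (by linarith), mul_one]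
  have hz0 := norm_nonneg z
  have hlow : h ≤ ‖1 - (starRingEnd ℂ) a * z‖ := by
    have := norm_sub_norm_le (1 : ℂ) ((starRingEnd ℂ) a * z)
    rw [norm_mul, RCLike.norm_conj, han, norm_one] at this
    nlinarith
  have hne : 1 - (starRingEnd ℂ) a * z ≠ 0 := norm_pos_iff.1 (by linarith)
  have hee : e * (starRingEnd ℂ) e = 1 := by rw [Complex.mul_conj', hen]; simp
  have hdist : ‖e - Complex.exp (Complex.I * t)‖ ≤ Real.pi * h := by
    have hx : Complex.exp (Complex.I * t) =
        e * Complex.exp (Complex.I * ((t - θ : ℝ) : ℂ)) := by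
      rw [he, ← Complex.exp_add]; congr 1; push_cast; ring
    have : e - Complex.exp (Complex.I * t) =
        -(e * (Complex.exp (Complex.I * ((t - θ : ℝ) : ℂ)) - 1)) := by rw [hx]; ring
    rw [this, norm_neg, norm_mul, hen, one_mul]
    exact (Real.norm_exp_I_mul_ofReal_sub_one_le).trans ht.le
  have hup : ‖1 - (starRingEnd ℂ) a * z‖ ≤ (2 + Real.pi) * h := by
    have hdec : 1 - (starRingEnd ℂ) a * z = (h : ℂ) + ((1 - h : ℝ) : ℂ) * (starRingEnd ℂ) e *
        (((1 - ‖z‖ : ℝ) : ℂ) * e + ((‖z‖ : ℝ) : ℂ) * (e - Complex.exp (Complex.I * t))) := by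
      have hz' : ((1 - ‖z‖ : ℝ) : ℂ) * e + ((‖z‖ : ℝ) : ℂ) * (e - Complex.exp (Complex.I * t))
          = e - z := by
        conv_rhs => rw [hzt]
        push_cast; ring
      rw [hz', ha, map_mul, Complex.conj_ofReal]
      push_cast
      linear_combination (-(1 - (h : ℂ))) * hee
    have hA : ‖((1 - ‖z‖ : ℝ) : ℂ) * e + ((‖z‖ : ℝ) : ℂ) * (e - Complex.exp (Complex.I * t))‖
        ≤ h + Real.pi * h := by
      refine (norm_add_le _ _).trans ?_
      rw [norm_mul, norm_mul, hen, Complex.norm_real, Complex.norm_real, norm_norm,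
        Real.norm_of_nonneg (by linarith)]
      have : ‖z‖ * ‖e - Complex.exp (Complex.I * t)‖ ≤ 1 * (Real.pi * h) := by gcongr
      linarith
    rw [hdec]
    refine (norm_add_le _ _).trans ?_
    rw [norm_mul, norm_mul, RCLike.norm_conj, hen, Complex.norm_real, Complex.norm_real,
      Real.norm_of_nonneg h0.le, Real.norm_of_nonneg (by linarith : 0 ≤ 1 - h)]
    have := mul_le_mul (by linarith : (1 - h) * 1 ≤ 1) hA (norm_nonneg _) zero_le_one
    linarith
  rw [moebius_identity a z hne, han, ← mul_div_assoc, le_div_iff₀ (by positivity)]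
  have hW : 0 ≤ 1 - ‖z‖ ^ 2 := by nlinarith
  have hN : ‖1 - (starRingEnd ℂ) a * z‖ ^ 2 ≤ (2 + Real.pi) ^ 2 * h * (1 - (1 - h) ^ 2) := by
    have h3 : ‖1 - (starRingEnd ℂ) a * z‖ ^ 2 ≤ ((2 + Real.pi) * h) ^ 2 := by gcongr
    have h4 : (2 + Real.pi) ^ 2 * h * h ≤ (2 + Real.pi) ^ 2 * h * (1 - (1 - h) ^ 2) := by
      gcongr
      nlinarith
    nlinarith
  nlinarith [mul_le_mul_of_nonneg_left hN hW]

theorem box_weight_rpow {p : ℝ} (hp0 : 0 < p) {θ h : ℝ} (hh : h ∈ Set.Ioc (0 : ℝ) 1) {z : ℂ}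
    (hz : z ∈ carlesonBox θ h) :
    (1 - ‖z‖ ^ 2) ^ p ≤ (((2 + Real.pi) ^ 2) ^ p * h ^ p) *
      (1 - ‖moebius ((1 - h : ℝ) * Complex.exp (Complex.I * θ)) z‖ ^ 2) ^ p := by
  have hb := box_weight hh hz
  have hc : 0 < (2 + Real.pi) ^ 2 * h := by
    have := hh.1
    positivity
  have h1 : 0 ≤ 1 - ‖z‖ ^ 2 := by nlinarith [hz.2.1, norm_nonneg z]
  have h2 : 0 ≤ 1 - ‖moebius ((1 - h : ℝ) * Complex.exp (Complex.I * θ)) z‖ ^ 2 :=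
    nonneg_of_mul_nonneg_right (h1.trans hb) hc
  rw [← Real.mul_rpow (by positivity) hh.1.le, ← Real.mul_rpow hc.le h2]
  exact Real.rpow_le_rpow h1 hb hp0.le

theorem carleson_of_bound {p : ℝ} (hp0 : 0 < p) {n : ℕ} {f : Fin n → ℂ → ℂ}
    (hf : ∀ l, MemQp p (f l)) (W : ℂ → ℝ)
    (hW : ∀ z ∈ unitDisk, W z ≤ 4 * ∑ l, ‖deriv (f l) z‖ ^ 2) :
    IsPCarleson p (diskMeasure fun z => W z * (1 - ‖z‖ ^ 2) ^ p) := by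
  choose _ _ C hC using hf
  refine ⟨4 * ((2 + Real.pi) ^ 2) ^ p * ∑ l, |C l|, fun θ h hh => ?_⟩
  set a : ℂ := (1 - h : ℝ) * Complex.exp (Complex.I * θ) with ha
  have haD : a ∈ unitDisk := by
    have hen : ‖Complex.exp (Complex.I * θ)‖ = 1 := by
      rw [mul_comm]; exact Complex.norm_exp_ofReal_mul_I θ
    rw [unitDisk, mem_ball_zero_iff, ha, norm_mul, hen, Complex.norm_real,
      Real.norm_of_nonneg (by linarith [hh.2])]
    linarith [hh.1]
  have hDm : MeasurableSet unitDisk := measurableSet_ball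
  set K : ℝ := 4 * (((2 + Real.pi) ^ 2) ^ p * h ^ p) with hK
  have hK0 : 0 ≤ K := by have := hh.1; positivity
  have hmeas : ∀ l, Measurable fun z =>
      ENNReal.ofReal (‖deriv (f l) z‖ ^ 2 * (1 - ‖moebius a z‖ ^ 2) ^ p) := by
    intro l
    have h1 : Measurable (deriv (f l)) := measurable_deriv (f l)
    have h2 : Measurable (moebius a) := by unfold moebius; fun_prop
    fun_prop
  rw [diskMeasure, withDensity_apply', Measure.restrict_restrict' hDm]
  calc ∫⁻ z in carlesonBox θ h ∩ unitDisk, ENNReal.ofReal (W z * (1 - ‖z‖ ^ 2) ^ p)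
      ≤ ∫⁻ z in carlesonBox θ h ∩ unitDisk, ENNReal.ofReal K *
          ∑ l, ENNReal.ofReal (‖deriv (f l) z‖ ^ 2 * (1 - ‖moebius a z‖ ^ 2) ^ p) := by
        refine setLIntegral_mono
          ((Finset.measurable_sum _ fun l _ => hmeas l).const_mul _) ?_
        intro z hz
        have hb := box_weight_rpow hp0 hh hz.1
        have h1 : 0 ≤ (1 - ‖z‖ ^ 2) ^ p :=
          Real.rpow_nonneg (by nlinarith [hz.1.2.1, norm_nonneg z]) _
        have hc : 0 < ((2 + Real.pi) ^ 2) ^ p * h ^ p := by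
          have := Real.rpow_pos_of_pos hh.1 p
          positivity
        have h2 : 0 ≤ (1 - ‖moebius a z‖ ^ 2) ^ p :=
          nonneg_of_mul_nonneg_right (h1.trans hb) hc
        rw [← ENNReal.ofReal_sum_of_nonneg (fun l _ => mul_nonneg (sq_nonneg _) h2),
          ← ENNReal.ofReal_mul hK0]
        refine ENNReal.ofReal_le_ofReal ?_
        rw [← Finset.sum_mul]
        have hD0 : 0 ≤ ∑ l, ‖deriv (f l) z‖ ^ 2 := Finset.sum_nonneg fun l _ => sq_nonneg _
        calc W z * (1 - ‖z‖ ^ 2) ^ p ≤ (4 * ∑ l, ‖deriv (f l) z‖ ^ 2) *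
              ((((2 + Real.pi) ^ 2) ^ p * h ^ p) * (1 - ‖moebius a z‖ ^ 2) ^ p) :=
              mul_le_mul (hW z hz.2) hb h1 (by positivity)
          _ = _ := by rw [hK]; ring
    _ ≤ ∫⁻ z in unitDisk, ENNReal.ofReal K *
          ∑ l, ENNReal.ofReal (‖deriv (f l) z‖ ^ 2 * (1 - ‖moebius a z‖ ^ 2) ^ p) :=
        lintegral_mono_set Set.inter_subset_right
    _ = ENNReal.ofReal K * ∑ l, qpIntegral p (f l) a := by
        rw [lintegral_const_mul _ (Finset.measurable_sum _ fun l _ => hmeas l),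
          lintegral_finsetSum _ fun l _ => hmeas l]
        rfl
    _ ≤ ENNReal.ofReal K * ∑ l, ENNReal.ofReal |C l| := by
        gcongr with l
        exact (hC l a haD).trans (ENNReal.ofReal_le_ofReal (le_abs_self _))
    _ = ENNReal.ofReal (4 * ((2 + Real.pi) ^ 2) ^ p * (∑ l, |C l|) * h ^ p) := by
        rw [← ENNReal.ofReal_sum_of_nonneg (fun l _ => abs_nonneg _), ← ENNReal.ofReal_mul hK0]
        congr 1
        rw [hK]; ring

/-- With `ψ_j = g f̄_j / ∑_l |f_l|²`, the data `G = g ψ_j ∂ψ_k/∂z̄` of the `∂̄`-problem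
satisfies `|G|² ≤ C ∑_l |f_l'|²` with an absolute constant `C`, and hence
`|G(z)|² (1-|z|²)^p dA(z)` is a `p`-Carleson measure whenever `f₁, …, fₙ ∈ Q_p`. -/
theorem dbar_data_pCarleson (p : ℝ) (hp0 : 0 < p) (hp1 : p < 1) :
    ∃ C : ℝ, 0 < C ∧
      ∀ (n : ℕ) (g : ℂ → ℂ) (f : Fin n → ℂ → ℂ) (U : Set ℂ),
        IsOpen U → Metric.closedBall (0 : ℂ) 1 ⊆ U →
        DifferentiableOn ℂ g U → (∀ j, DifferentiableOn ℂ (f j) U) →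
        (∀ l, MemQp p (f l)) →
        (∀ z ∈ unitDisk, 0 < ∑ l, ‖f l z‖ ^ 2) →
        (∀ z ∈ unitDisk, ‖g z‖ ≤ Real.sqrt (∑ l, ‖f l z‖ ^ 2)) →
        ∀ j k : Fin n,
          (∀ z ∈ unitDisk,
            ‖g z * (g z * (starRingEnd ℂ) (f j z) / ((∑ l, ‖f l z‖ ^ 2 : ℝ) : ℂ)) *
                wderivBar (fun w => g w * (starRingEnd ℂ) (f k w) /
                  ((∑ l, ‖f l w‖ ^ 2 : ℝ) : ℂ)) z‖ ^ 2 ≤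
              C * ∑ l, ‖deriv (f l) z‖ ^ 2) ∧
          IsPCarleson p (diskMeasure fun z =>
            ‖g z * (g z * (starRingEnd ℂ) (f j z) / ((∑ l, ‖f l z‖ ^ 2 : ℝ) : ℂ)) *
                wderivBar (fun w => g w * (starRingEnd ℂ) (f k w) /
                  ((∑ l, ‖f l w‖ ^ 2 : ℝ) : ℂ)) z‖ ^ 2 * (1 - ‖z‖ ^ 2) ^ p) := by
  refine ⟨4, by norm_num, ?_⟩
  intro n g f U hU hUb hg hf hQ hS hgS j k
  have hbound : ∀ z ∈ unitDisk,
      ‖g z * (g z * (starRingEnd ℂ) (f j z) / ((∑ l, ‖f l z‖ ^ 2 : ℝ) : ℂ)) *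
          wderivBar (fun w => g w * (starRingEnd ℂ) (f k w) /
            ((∑ l, ‖f l w‖ ^ 2 : ℝ) : ℂ)) z‖ ^ 2 ≤ 4 * ∑ l, ‖deriv (f l) z‖ ^ 2 := by
    intro z hz
    have hzU : U ∈ nhds z := hU.mem_nhds (hUb (Metric.ball_subset_closedBall hz))
    rw [wbar_psi (hg.differentiableAt hzU) (fun l => (hf l).differentiableAt hzU) (hS z hz) k]
    exact norm_bound (fun l => f l z) (fun l => deriv (f l) z) (g z) (hS z hz) (hgS z hz) j k
  exact ⟨hbound, carleson_of_bound hp0 hQ _ hbound⟩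
end
end
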